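/- arXiv:2307.05088 — 3 statements merged into one kernel-verified Lean document; each statement's English description precedes it below -/
import Mathlib

section
/- Let n ≥ 2 and let φ be a positive C² solution of the rotational soliton ODE z·φ''/(1+(φ')²) − ((1+nz)/z)·φ' − (n−1)z/φ = 0 defined in a neighbourhood of a point z₀ > 0, with φ'(z₀) ≥ 0 or φ''(z₀) > 0. Then there exist 0 < λ₀ < h < ∞ with z₀ ∈ (λ₀, h) such that φ extends to a positive solution on [λ₀, h) satisfying: φ'' > 0 on (λ₀, h), φ'(λ₀) < 0 and φ''(λ₀) = 0; lim_{z→h⁻} φ(z) exists, is finite and positive; lim_{z→h⁻} φ'(z) = +∞; and φ attains a unique minimum on (λ₀, h). -/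
open Set Filter Topology

/-- The rotational soliton ODE `z·φ''/(1+(φ')²) − ((1+nz)/z)·φ' − (n−1)z/φ = 0` at `z`. -/
def RotODE (n : ℕ) (φ : ℝ → ℝ) (z : ℝ) : Prop :=
  z * deriv (deriv φ) z / (1 + (deriv φ z) ^ 2) -
    ((1 + (n : ℝ) * z) / z) * deriv φ z - ((n : ℝ) - 1) * z / φ z = 0

/-- The curvature factor of the soliton ODE, solved for `φ'' / (1 + φ'²)`. -/
noncomputable def bend (n : ℕ) (z y p : ℝ) : ℝ :=
  (1 / z ^ 2 + n / z) * p + ((n : ℝ) - 1) / y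

/-- `(y, p)` solves, at `z`, the first order system equivalent to the soliton ODE. -/
structure IsSol (n : ℕ) (y p : ℝ → ℝ) (z : ℝ) : Prop where
  zpos : 0 < z
  pos : 0 < y z
  dy : HasDerivAt y (p z) z
  dp : HasDerivAt p ((1 + p z ^ 2) * bend n z (y z) (p z)) z

theorem IsSol.congr {n : ℕ} {y p y' p' : ℝ → ℝ} {z : ℝ} (h : IsSol n y p z)
    (hy : y' =ᶠ[𝓝 z] y) (hp : p' =ᶠ[𝓝 z] p) : IsSol n y' p' z := by
  have e1 := hy.eq_of_nhds
  have e2 := hp.eq_of_nhds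
  refine ⟨h.zpos, e1 ▸ h.pos, ?_, ?_⟩
  · rw [e2]; exact h.dy.congr_of_eventuallyEq hy
  · rw [e1, e2]; exact h.dp.congr_of_eventuallyEq hp

theorem monotoneOn_of_hasDerivAt_nonneg {D : Set ℝ} (hD : Convex ℝ D) {f f' : ℝ → ℝ}
    (hf : ∀ x ∈ D, HasDerivAt f (f' x) x) (hf' : ∀ x ∈ D, 0 ≤ f' x) : MonotoneOn f D :=
  monotoneOn_of_hasDerivWithinAt_nonneg hD
    (fun x hx => (hf x hx).continuousAt.continuousWithinAt)
    (fun x hx => (hf x (interior_subset hx)).hasDerivWithinAt)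
    (fun x hx => hf' x (interior_subset hx))

theorem strictMonoOn_of_hasDerivAt_pos {D : Set ℝ} (hD : Convex ℝ D) {f f' : ℝ → ℝ}
    (hf : ∀ x ∈ D, HasDerivAt f (f' x) x) (hf' : ∀ x ∈ D, 0 < f' x) : StrictMonoOn f D :=
  strictMonoOn_of_hasDerivWithinAt_pos hD
    (fun x hx => (hf x hx).continuousAt.continuousWithinAt)
    (fun x hx => (hf x (interior_subset hx)).hasDerivWithinAt)
    (fun x hx => hf' x (interior_subset hx))

theorem hasDerivAt_of_eventually_hasDerivAt_of_ne {f g : ℝ → ℝ} {x : ℝ}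
    (h : ∀ᶠ t in 𝓝[≠] x, HasDerivAt f (g t) t) (hf : ContinuousAt f x)
    (hg : ContinuousAt g x) : HasDerivAt f (g x) x := by
  have hl : ∀ᶠ t in 𝓝[<] x, HasDerivAt f (g t) t :=
    h.filter_mono (nhdsWithin_mono _ fun t ht => ne_of_lt ht)
  have hr : ∀ᶠ t in 𝓝[>] x, HasDerivAt f (g t) t :=
    h.filter_mono (nhdsWithin_mono _ fun t ht => ne_of_gt ht)
  have A : HasDerivWithinAt f (g x) (Iic x) x := by
    refine hasDerivWithinAt_Iic_of_tendsto_deriv (s := {t | HasDerivAt f (g t) t})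
      (fun t ht => (HasDerivAt.differentiableAt ht).differentiableWithinAt)
      hf.continuousWithinAt hl ?_
    refine (hg.tendsto.mono_left nhdsWithin_le_nhds).congr' ?_
    filter_upwards [hl] with t ht using ht.deriv.symm
  have B : HasDerivWithinAt f (g x) (Ici x) x := by
    refine hasDerivWithinAt_Ici_of_tendsto_deriv (s := {t | HasDerivAt f (g t) t})
      (fun t ht => (HasDerivAt.differentiableAt ht).differentiableWithinAt)
      hf.continuousWithinAt hr ?_
    refine (hg.tendsto.mono_left nhdsWithin_le_nhds).congr' ?_
    filter_upwards [hr] with t ht using ht.deriv.symm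
  simpa using A.union B

/-- The autonomous vector field on `(z, y, p)`-space whose integral curves are solutions. -/
noncomputable def solField (n : ℕ) (x : ℝ × ℝ × ℝ) : ℝ × ℝ × ℝ :=
  (1, x.2.2, (1 + x.2.2 ^ 2) * bend n x.1 x.2.1 x.2.2)

theorem contDiffAt_solField (n : ℕ) {x : ℝ × ℝ × ℝ} (h1 : x.1 ≠ 0) (h2 : x.2.1 ≠ 0) :
    ContDiffAt ℝ 1 (solField n) x := by
  unfold solField bend
  have h3 : x.1 ^ 2 ≠ 0 := pow_ne_zero 2 h1
  fun_prop (disch := assumption)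

theorem IsSol.hasDerivAt_solField {n : ℕ} {y p : ℝ → ℝ} {z : ℝ} (h : IsSol n y p z) :
    HasDerivAt (fun t => (t, y t, p t)) (solField n (z, y z, p z)) z :=
  (hasDerivAt_id z).prodMk (h.dy.prodMk h.dp)

theorem exists_local_isSol (n : ℕ) {z₁ Y P : ℝ} (hz : 0 < z₁) (hY : 0 < Y) :
    ∃ ε > 0, ∃ y p : ℝ → ℝ, y z₁ = Y ∧ p z₁ = P ∧
      ∀ z ∈ Ioo (z₁ - ε) (z₁ + ε), IsSol n y p z := by
  obtain ⟨α, h0, ε, hε, hα⟩ :=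
    (contDiffAt_solField n (x := (z₁, Y, P)) hz.ne' hY.ne')
      |>.exists_forall_mem_closedBall_exists_eq_forall_mem_Ioo_hasDerivAt₀ z₁
  have d1 : ∀ t ∈ Ioo (z₁ - ε) (z₁ + ε), HasDerivAt (fun t => (α t).1) 1 t := fun t ht => by
    have := (hα t ht).hasFDerivAt.fst.hasDerivAt
    simpa [solField] using this
  have d2 : ∀ t ∈ Ioo (z₁ - ε) (z₁ + ε), HasDerivAt (fun t => (α t).2.1) (α t).2.2 t :=
    fun t ht => by
      have := (hα t ht).hasFDerivAt.snd.fst.hasDerivAt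
      simpa [solField] using this
  have d3 : ∀ t ∈ Ioo (z₁ - ε) (z₁ + ε), HasDerivAt (fun t => (α t).2.2)
      ((1 + (α t).2.2 ^ 2) * bend n (α t).1 (α t).2.1 (α t).2.2) t :=
    fun t ht => by
      have := (hα t ht).hasFDerivAt.snd.snd.hasDerivAt
      simpa [solField] using this
  have m0 : z₁ ∈ Ioo (z₁ - ε) (z₁ + ε) := by constructor <;> linarith
  have e1 : ∀ t ∈ Ioo (z₁ - ε) (z₁ + ε), (α t).1 = t := by
    have := isOpen_Ioo.eqOn_of_deriv_eq (s := Ioo (z₁ - ε) (z₁ + ε)) isPreconnected_Ioo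
      (f := fun t => (α t).1) (g := fun t => t)
      (fun t ht => (d1 t ht).differentiableAt.differentiableWithinAt)
      differentiableOn_id (fun t ht => by simp [(d1 t ht).deriv]) m0 (by simp [h0])
    exact this
  have c2 : ContinuousAt (fun t => (α t).2.1) z₁ := (d2 z₁ m0).continuousAt
  have ev : ∀ᶠ t in 𝓝 z₁, 0 < (α t).2.1 ∧ 0 < t :=
    (c2.eventually (lt_mem_nhds (by simpa [h0] using hY))).and (lt_mem_nhds hz)
  obtain ⟨δ, hδ, hb⟩ := Metric.eventually_nhds_iff_ball.1 ev
  rw [Real.ball_eq_Ioo] at hb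
  refine ⟨min ε δ, lt_min hε hδ, fun t => (α t).2.1, fun t => (α t).2.2, by simp [h0],
    by simp [h0], fun t ht => ?_⟩
  have m1 : t ∈ Ioo (z₁ - ε) (z₁ + ε) :=
    ⟨by linarith [ht.1, min_le_left ε δ], by linarith [ht.2, min_le_left ε δ]⟩
  have m2 : t ∈ Ioo (z₁ - δ) (z₁ + δ) :=
    ⟨by linarith [ht.1, min_le_right ε δ], by linarith [ht.2, min_le_right ε δ]⟩
  have := d3 t m1
  rw [e1 t m1] at this
  exact ⟨(hb t m2).2, (hb t m2).1, d2 t m1, this⟩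

theorem IsSol.eventuallyEq {n : ℕ} {y p y' p' : ℝ → ℝ} {z : ℝ}
    (h : ∀ᶠ t in 𝓝 z, IsSol n y p t) (h' : ∀ᶠ t in 𝓝 z, IsSol n y' p' t)
    (hy : y z = y' z) (hp : p z = p' z) : ∀ᶠ t in 𝓝 z, y t = y' t ∧ p t = p' t := by
  have hz := h.self_of_nhds
  obtain ⟨K, s, hs, hK⟩ := (contDiffAt_solField n (x := (z, y z, p z)) hz.zpos.ne'
    hz.pos.ne').exists_lipschitzOnWith
  have hs' : s ∈ 𝓝 (z, y' z, p' z) := by rwa [← hy, ← hp]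
  have := ODE_solution_unique_of_eventually (v := fun _ => solField n) (s := fun _ => s)
    (t₀ := z) (f := fun t => (t, y t, p t)) (g := fun t => (t, y' t, p' t)) (K := K)
    (Eventually.of_forall fun _ => hK)
    ((h.mono fun t ht => ht.hasDerivAt_solField).and
      (hz.hasDerivAt_solField.continuousAt.eventually hs))
    ((h'.mono fun t ht => ht.hasDerivAt_solField).and
      (h'.self_of_nhds.hasDerivAt_solField.continuousAt.eventually hs'))
    (by simp [hy, hp])
  filter_upwards [this] with t ht
  simpa using ht

theorem IsSol.eqOn {n : ℕ} {y p y' p' : ℝ → ℝ} {a b z : ℝ} (hz : z ∈ Ioo a b)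
    (h : ∀ t ∈ Ioo a b, IsSol n y p t) (h' : ∀ t ∈ Ioo a b, IsSol n y' p' t)
    (hy : y z = y' z) (hp : p z = p' z) : ∀ t ∈ Ioo a b, y t = y' t ∧ p t = p' t := by
  have key : ∀ t ∈ Ioo a b, y t = y' t → p t = p' t → ∀ᶠ s in 𝓝 t, y s = y' s ∧ p s = p' s :=
    fun t ht e1 e2 => IsSol.eventuallyEq
      (Filter.eventually_of_mem (isOpen_Ioo.mem_nhds ht) h)
      (Filter.eventually_of_mem (isOpen_Ioo.mem_nhds ht) h') e1 e2
  have sub : Ioo a b ⊆ {t | ∀ᶠ s in 𝓝 t, y s = y' s ∧ p s = p' s} := by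
    refine isPreconnected_Ioo.subset_of_closure_inter_subset isOpen_setOfPred_eventually_nhds
      ⟨z, hz, key z hz hy hp⟩ ?_
    rintro t ⟨htc, ht⟩
    have fr : ∃ᶠ s in 𝓝 t, y s = y' s ∧ p s = p' s :=
      (mem_closure_iff_frequently.1 htc).mono fun s hs => hs.self_of_nhds
    have c1 := (h t ht).dy.continuousAt.sub (h' t ht).dy.continuousAt
    have c2 := (h t ht).dp.continuousAt.sub (h' t ht).dp.continuousAt
    refine key t ht ?_ ?_
    · by_contra hne
      have := c1.eventually_ne (sub_ne_zero.2 hne)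
      obtain ⟨s, hs, hs'⟩ := (fr.and_eventually this).exists
      exact hs' (by simp [hs.1])
    · by_contra hne
      have := c2.eventually_ne (sub_ne_zero.2 hne)
      obtain ⟨s, hs, hs'⟩ := (fr.and_eventually this).exists
      exact hs' (by simp [hs.2])
  exact fun t ht => (sub ht).self_of_nhds

/-- `(y, p)` is a solution on the interval `I ∋ z₀`, and no solution with the same data at `z₀`
lives on an interval not contained in `I`. -/
structure IsMaxSol_s12 (n : ℕ) (z₀ : ℝ) (I : Set ℝ) (y p : ℝ → ℝ) : Prop where
  isOpen : IsOpen I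
  ordConnected : I.OrdConnected
  mem : z₀ ∈ I
  sol : ∀ z ∈ I, IsSol n y p z
  maximal : ∀ (a b : ℝ) (y' p' : ℝ → ℝ), z₀ ∈ Ioo a b → (∀ z ∈ Ioo a b, IsSol n y' p' z) →
    y' z₀ = y z₀ → p' z₀ = p z₀ → Ioo a b ⊆ I

theorem exists_isMaxSol {n : ℕ} {z₀ : ℝ} {y₀ p₀ : ℝ → ℝ}
    (h₀ : ∀ᶠ z in 𝓝 z₀, IsSol n y₀ p₀ z) :
    ∃ I y p, IsMaxSol_s12 n z₀ I y p ∧ ∀ᶠ z in 𝓝 z₀, y z = y₀ z ∧ p z = p₀ z := by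
  classical
  let Q : ℝ → (ℝ → ℝ) × (ℝ → ℝ) × ℝ × ℝ → Prop := fun z w =>
    z ∈ Ioo w.2.2.1 w.2.2.2 ∧ z₀ ∈ Ioo w.2.2.1 w.2.2.2 ∧
      (∀ t ∈ Ioo w.2.2.1 w.2.2.2, IsSol n w.1 w.2.1 t) ∧ w.1 z₀ = y₀ z₀ ∧ w.2.1 z₀ = p₀ z₀
  let I : Set ℝ := {z | ∃ w, Q z w}
  let y : ℝ → ℝ := fun z => if h : ∃ w, Q z w then h.choose.1 z else 0
  let p : ℝ → ℝ := fun z => if h : ∃ w, Q z w then h.choose.2.1 z else 0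
  have key : ∀ z w, Q z w → y z = w.1 z ∧ p z = w.2.1 z := by
    intro z w hw
    have hex : ∃ w, Q z w := ⟨w, hw⟩
    have hc := hex.choose_spec
    simp only [y, p, dif_pos hex]
    set v := hex.choose
    obtain ⟨a1, a2, a3, a4, a5⟩ := hw
    obtain ⟨b1, b2, b3, b4, b5⟩ := hc
    refine IsSol.eqOn (n := n) (a := max v.2.2.1 w.2.2.1) (b := min v.2.2.2 w.2.2.2) (z := z₀)
      ⟨max_lt b2.1 a2.1, lt_min b2.2 a2.2⟩ (fun t ht => b3 t ⟨?_, ?_⟩)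
      (fun t ht => a3 t ⟨?_, ?_⟩) (b4.trans a4.symm) (b5.trans a5.symm) z
      ⟨max_lt b1.1 a1.1, lt_min b1.2 a1.2⟩
    · exact (le_max_left _ _).trans_lt ht.1
    · exact ht.2.trans_le (min_le_left _ _)
    · exact (le_max_right _ _).trans_lt ht.1
    · exact ht.2.trans_le (min_le_right _ _)
  have near : ∀ z w, Q z w → ∀ᶠ t in 𝓝 z, Q t w := fun z w hw =>
    Filter.mem_of_superset (isOpen_Ioo.mem_nhds hw.1) fun t ht => ⟨ht, hw.2⟩
  obtain ⟨δ, hδ, hb⟩ := Metric.eventually_nhds_iff_ball.1 h₀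
  rw [Real.ball_eq_Ioo] at hb
  have m0 : z₀ ∈ Ioo (z₀ - δ) (z₀ + δ) := by constructor <;> linarith
  have hQ0 : Q z₀ (y₀, p₀, z₀ - δ, z₀ + δ) := ⟨m0, m0, hb, rfl, rfl⟩
  have k0 := key _ _ hQ0
  refine ⟨I, y, p, ⟨?_, ?_, ⟨_, hQ0⟩, ?_, ?_⟩, ?_⟩
  · rw [isOpen_iff_mem_nhds]
    rintro z ⟨w, hw⟩
    filter_upwards [near z w hw] with t ht using ⟨w, ht⟩
  · refine ordConnected_of_uIcc_subset_left (x := z₀) ?_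
    rintro z ⟨w, hw⟩ t ht
    exact ⟨w, ordConnected_Ioo.uIcc_subset hw.2.1 hw.1 ht, hw.2⟩
  · rintro z ⟨w, hw⟩
    refine (hw.2.2.1 z hw.1).congr ?_ ?_
    · filter_upwards [near z w hw] with t ht using (key t w ht).1
    · filter_upwards [near z w hw] with t ht using (key t w ht).2
  · intro a b y' p' hm hs e1 e2 t ht
    exact ⟨(y', p', a, b), ht, hm, hs, e1.trans k0.1, e2.trans k0.2⟩
  · filter_upwards [near _ _ hQ0] with t ht using key _ _ ht

theorem exists_isSol_glue {n : ℕ} {y₁ p₁ y₂ p₂ : ℝ → ℝ} {a b c Y P : ℝ} (hab : a < b)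
    (hbc : b < c) (hb : 0 < b) (hY : 0 < Y)
    (h₁ : ∀ z ∈ Ioo a b, IsSol n y₁ p₁ z) (h₂ : ∀ z ∈ Ioo b c, IsSol n y₂ p₂ z)
    (ty₁ : Tendsto y₁ (𝓝[<] b) (𝓝 Y)) (tp₁ : Tendsto p₁ (𝓝[<] b) (𝓝 P))
    (ty₂ : Tendsto y₂ (𝓝[>] b) (𝓝 Y)) (tp₂ : Tendsto p₂ (𝓝[>] b) (𝓝 P)) :
    ∃ y p, (∀ z ∈ Ioo a c, IsSol n y p z) ∧ (∀ z < b, y z = y₁ z ∧ p z = p₁ z) ∧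
      ∀ z > b, y z = y₂ z ∧ p z = p₂ z := by
  classical
  let G : (ℝ → ℝ) → (ℝ → ℝ) → ℝ → ℝ → ℝ := fun f g V z =>
    if z < b then f z else if b < z then g z else V
  have Gl : ∀ f g V z, z < b → G f g V z = f z := fun f g V z h => by simp [G, h]
  have Gr : ∀ f g V z, b < z → G f g V z = g z := fun f g V z h => by simp [G, h, h.le]
  have Gb : ∀ f g V, G f g V b = V := fun f g V => by simp [G]
  have Gc : ∀ f g V, Tendsto f (𝓝[<] b) (𝓝 V) → Tendsto g (𝓝[>] b) (𝓝 V) →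
      ContinuousAt (G f g V) b := by
    intro f g V hf hg
    rw [continuousAt_iff_continuous_left'_right']
    refine ⟨?_, ?_⟩
    · rw [ContinuousWithinAt, Gb]
      refine hf.congr' ?_
      filter_upwards [self_mem_nhdsWithin] with t ht using (Gl f g V t ht).symm
    · rw [ContinuousWithinAt, Gb]
      refine hg.congr' ?_
      filter_upwards [self_mem_nhdsWithin] with t ht using (Gr f g V t ht).symm
  set y := G y₁ y₂ Y with hy
  set p := G p₁ p₂ P with hp
  have sl : ∀ z ∈ Ioo a b, IsSol n y p z := fun z hz => by
    refine (h₁ z hz).congr ?_ ?_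
    · filter_upwards [gt_mem_nhds hz.2] with t ht using Gl _ _ _ t ht
    · filter_upwards [gt_mem_nhds hz.2] with t ht using Gl _ _ _ t ht
  have sr : ∀ z ∈ Ioo b c, IsSol n y p z := fun z hz => by
    refine (h₂ z hz).congr ?_ ?_
    · filter_upwards [lt_mem_nhds hz.1] with t ht using Gr _ _ _ t ht
    · filter_upwards [lt_mem_nhds hz.1] with t ht using Gr _ _ _ t ht
  have cy : ContinuousAt y b := Gc _ _ _ ty₁ ty₂
  have cp : ContinuousAt p b := Gc _ _ _ tp₁ tp₂
  have yb : y b = Y := Gb _ _ _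
  have ev : ∀ᶠ t in 𝓝[≠] b, IsSol n y p t := by
    rw [eventually_nhdsWithin_iff]
    filter_upwards [isOpen_Ioo.mem_nhds (show b ∈ Ioo a c from ⟨hab, hbc⟩)] with t ht hne
    rcases lt_or_gt_of_ne hne with h | h
    · exact sl t ⟨ht.1, h⟩
    · exact sr t ⟨h, ht.2⟩
  have sb : IsSol n y p b := by
    refine ⟨hb, yb ▸ hY, ?_, ?_⟩
    · exact hasDerivAt_of_eventually_hasDerivAt_of_ne (ev.mono fun t ht => ht.dy) cy cp
    · refine hasDerivAt_of_eventually_hasDerivAt_of_ne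
        (g := fun t => (1 + p t ^ 2) * bend n t (y t) (p t)) (ev.mono fun t ht => ht.dp) cp ?_
      have n1 : b ^ 2 ≠ 0 := by positivity
      have n2 : b ≠ 0 := hb.ne'
      have n3 : y b ≠ 0 := yb ▸ hY.ne'
      unfold bend
      fun_prop (disch := assumption)
  refine ⟨y, p, fun z hz => ?_, fun z hz => ⟨Gl _ _ _ z hz, Gl _ _ _ z hz⟩,
    fun z hz => ⟨Gr _ _ _ z hz, Gr _ _ _ z hz⟩⟩
  rcases lt_trichotomy z b with h | h | h
  · exact sl z ⟨hz.1, h⟩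
  · exact h ▸ sb
  · exact sr z ⟨h, hz.2⟩

theorem IsMaxSol_s12.exists_Ioo_subset {n : ℕ} {z₀ : ℝ} {I : Set ℝ} {y p : ℝ → ℝ}
    (h : IsMaxSol_s12 n z₀ I y p) : ∃ δ > 0, Ioo (z₀ - δ) (z₀ + δ) ⊆ I := by
  obtain ⟨δ, hδ, hb⟩ := Metric.isOpen_iff.1 h.isOpen z₀ h.mem
  exact ⟨δ, hδ, Real.ball_eq_Ioo z₀ δ ▸ hb⟩

theorem IsMaxSol_s12.not_tendsto_right {n : ℕ} {z₀ b Y P : ℝ} {I : Set ℝ} {y p : ℝ → ℝ}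
    (h : IsMaxSol_s12 n z₀ I y p) (hb : z₀ < b) (hI : Ico z₀ b ⊆ I) (hbI : b ∉ I) (hY : 0 < Y)
    (tY : Tendsto y (𝓝[<] b) (𝓝 Y)) (tP : Tendsto p (𝓝[<] b) (𝓝 P)) : False := by
  have hb0 : 0 < b := (h.sol z₀ h.mem).zpos.trans hb
  obtain ⟨δ, hδ, hδI⟩ := h.exists_Ioo_subset
  obtain ⟨ε, hε, y₂, p₂, e1, e2, h₂⟩ := exists_local_isSol n (P := P) hb0 hY
  have hs : IsSol n y₂ p₂ b := h₂ b ⟨by linarith, by linarith⟩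
  obtain ⟨y', p', s, l, -⟩ := exists_isSol_glue (a := z₀ - δ) (b := b) (c := b + ε)
    (by linarith) (by linarith) hb0 hY
    (fun z hz => h.sol z (by
      rcases lt_or_ge z z₀ with hlt | hge
      · exact hδI ⟨hz.1, by linarith⟩
      · exact hI ⟨hge, hz.2⟩))
    (fun z hz => h₂ z ⟨by linarith [hz.1], hz.2⟩) tY tP
    (e1 ▸ hs.dy.continuousAt.tendsto.mono_left nhdsWithin_le_nhds)
    (e2 ▸ hs.dp.continuousAt.tendsto.mono_left nhdsWithin_le_nhds)
  exact hbI (h.maximal _ _ y' p' ⟨by linarith, by linarith⟩ s (l z₀ hb).1 (l z₀ hb).2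
    ⟨by linarith, by linarith⟩)

theorem IsMaxSol_s12.not_tendsto_left {n : ℕ} {z₀ a Y P : ℝ} {I : Set ℝ} {y p : ℝ → ℝ}
    (h : IsMaxSol_s12 n z₀ I y p) (ha0 : 0 < a) (ha : a < z₀) (hI : Ioc a z₀ ⊆ I) (haI : a ∉ I)
    (hY : 0 < Y) (tY : Tendsto y (𝓝[>] a) (𝓝 Y)) (tP : Tendsto p (𝓝[>] a) (𝓝 P)) :
    False := by
  obtain ⟨δ, hδ, hδI⟩ := h.exists_Ioo_subset
  obtain ⟨ε, hε, y₂, p₂, e1, e2, h₂⟩ := exists_local_isSol n (P := P) ha0 hY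
  have hs : IsSol n y₂ p₂ a := h₂ a ⟨by linarith, by linarith⟩
  obtain ⟨y', p', s, -, r⟩ := exists_isSol_glue (a := a - ε) (b := a) (c := z₀ + δ)
    (by linarith) (by linarith) ha0 hY
    (fun z hz => h₂ z ⟨hz.1, by linarith [hz.2]⟩)
    (fun z hz => h.sol z (by
      rcases lt_or_ge z₀ z with hlt | hge
      · exact hδI ⟨by linarith, hz.2⟩
      · exact hI ⟨hz.1, hge⟩))
    (e1 ▸ hs.dy.continuousAt.tendsto.mono_left nhdsWithin_le_nhds)
    (e2 ▸ hs.dp.continuousAt.tendsto.mono_left nhdsWithin_le_nhds) tY tP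
  exact haI (h.maximal _ _ y' p' ⟨by linarith, by linarith⟩ s (r z₀ ha).1 (r z₀ ha).2
    ⟨by linarith, by linarith⟩)

theorem exists_continuous_eqOn_Ioo {y p : ℝ → ℝ} {a b M : ℝ}
    (hd : ∀ z ∈ Ioo a b, HasDerivAt y (p z) z) (hM : ∀ z ∈ Ioo a b, |p z| ≤ M) :
    ∃ g : ℝ → ℝ, Continuous g ∧ EqOn y g (Ioo a b) := by
  have := (convex_Ioo a b).lipschitzOnWith_of_nnnorm_hasDerivWithin_le (C := M.toNNReal)
    (fun z hz => (hd z hz).hasDerivWithinAt) (fun z hz => by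
      rw [← NNReal.coe_le_coe, coe_nnnorm, Real.norm_eq_abs]
      exact (hM z hz).trans (Real.le_coe_toNNReal M))
  obtain ⟨g, hg, he⟩ := this.extend_real
  exact ⟨g, hg.continuous, he⟩

theorem IsMaxSol_s12.not_bounded_right {n : ℕ} {z₀ b c m M : ℝ} {I : Set ℝ} {y p : ℝ → ℝ}
    (h : IsMaxSol_s12 n z₀ I y p) (hb : z₀ < b) (hI : Ico z₀ b ⊆ I) (hbI : b ∉ I)
    (hc : z₀ ≤ c) (hcb : c < b) (hm : 0 < m) (hmy : ∀ z ∈ Ioo c b, m ≤ y z)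
    (hM : ∀ z ∈ Ioo c b, |p z| ≤ M) (hp : MonotoneOn p (Ioo c b)) : False := by
  obtain ⟨g, hg, he⟩ := exists_continuous_eqOn_Ioo
    (fun z hz => (h.sol z (hI ⟨hc.trans hz.1.le, hz.2⟩)).dy) hM
  have tY : Tendsto y (𝓝[<] b) (𝓝 (g b)) := by
    refine (hg.continuousAt.tendsto.mono_left nhdsWithin_le_nhds).congr' ?_
    filter_upwards [Ioo_mem_nhdsLT hcb] with t ht using (he ht).symm
  have hY : m ≤ g b := ge_of_tendsto tY (by
    filter_upwards [Ioo_mem_nhdsLT hcb] with t ht using hmy t ht)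
  refine h.not_tendsto_right hb hI hbI (hm.trans_le hY) tY
    (hp.tendsto_nhdsWithin_Ioo_left (nonempty_Ioo.2 hcb) ⟨M, ?_⟩)
  rintro _ ⟨z, hz, rfl⟩
  exact (le_abs_self _).trans (hM z hz)

theorem IsMaxSol_s12.not_bounded_left {n : ℕ} {z₀ a c m M : ℝ} {I : Set ℝ} {y p : ℝ → ℝ}
    (h : IsMaxSol_s12 n z₀ I y p) (ha0 : 0 < a) (ha : a < z₀) (hI : Ioc a z₀ ⊆ I) (haI : a ∉ I)
    (hc : c ≤ z₀) (hac : a < c) (hm : 0 < m) (hmy : ∀ z ∈ Ioo a c, m ≤ y z)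
    (hM : ∀ z ∈ Ioo a c, |p z| ≤ M) (hp : MonotoneOn p (Ioo a c)) : False := by
  obtain ⟨g, hg, he⟩ := exists_continuous_eqOn_Ioo
    (fun z hz => (h.sol z (hI ⟨hz.1, hz.2.le.trans hc⟩)).dy) hM
  have tY : Tendsto y (𝓝[>] a) (𝓝 (g a)) := by
    refine (hg.continuousAt.tendsto.mono_left nhdsWithin_le_nhds).congr' ?_
    filter_upwards [Ioo_mem_nhdsGT hac] with t ht using (he ht).symm
  have hY : m ≤ g a := ge_of_tendsto tY (by
    filter_upwards [Ioo_mem_nhdsGT hac] with t ht using hmy t ht)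
  refine h.not_tendsto_left ha0 ha hI haI (hm.trans_le hY) tY
    (hp.tendsto_nhdsWithin_Ioo_right (nonempty_Ioo.2 hac) ⟨-M, ?_⟩)
  rintro _ ⟨z, hz, rfl⟩
  exact neg_le_of_abs_le (hM z hz)

theorem pos_of_deriv_pos_of_eq_zero {f f' : ℝ → ℝ} {a b : ℝ}
    (hd : ∀ x ∈ Icc a b, HasDerivAt f (f' x) x) (ha : 0 ≤ f a)
    (h0 : ∀ x ∈ Icc a b, f x = 0 → 0 < f' x) : ∀ x ∈ Ioc a b, 0 < f x := by
  have nn : ∀ x ∈ Icc a b, 0 ≤ f x := by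
    have := image_le_of_deriv_right_lt_deriv_boundary (f := fun x => -f x) (f' := fun x => -f' x)
      (a := a) (b := b) (B := fun _ => 0) (B' := fun _ => 0)
      (fun x hx => (hd x hx).neg.continuousAt.continuousWithinAt)
      (fun x hx => (hd x ⟨hx.1, hx.2.le⟩).neg.hasDerivWithinAt) (by simpa using ha)
      (fun x => hasDerivAt_const x 0)
      (fun x hx he => by simpa using h0 x ⟨hx.1, hx.2.le⟩ (by simpa using he))
    intro x hx
    simpa using this hx
  intro x hx
  refine (nn x ⟨hx.1.le, hx.2⟩).lt_of_ne fun he => ?_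
  have hx' : x ∈ Icc a b := ⟨hx.1.le, hx.2⟩
  have hpos := h0 x hx' he.symm
  have hs := (hasDerivWithinAt_iff_tendsto_slope' (s := Iio x) (by simp)).1
    (hd x hx').hasDerivWithinAt
  obtain ⟨t, ht, htI⟩ := ((hs.eventually (lt_mem_nhds hpos)).and (Ioo_mem_nhdsLT hx.1)).exists
  rw [slope_def_field, ← he, sub_zero] at ht
  have := div_nonpos_of_nonneg_of_nonpos (nn t ⟨htI.1.le, htI.2.le.trans hx.2⟩)
    (sub_nonpos.2 htI.2.le)
  linarith

theorem IsSol.hasDerivAt_bend {n : ℕ} {y p : ℝ → ℝ} {z : ℝ} (h : IsSol n y p z) :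
    HasDerivAt (fun t => bend n t (y t) (p t))
      ((-2 / z ^ 3 - n / z ^ 2) * p z +
        (1 / z ^ 2 + n / z) * ((1 + p z ^ 2) * bend n z (y z) (p z)) -
        ((n : ℝ) - 1) * p z / y z ^ 2) z := by
  have hz := h.zpos.ne'
  have hy := h.pos.ne'
  have d1 : HasDerivAt (fun t : ℝ => 1 / t ^ 2 + (n : ℝ) / t) (-2 / z ^ 3 - n / z ^ 2) z := by
    have := ((hasDerivAt_const z (1 : ℝ)).div (hasDerivAt_pow 2 z) (pow_ne_zero 2 hz)).add
      ((hasDerivAt_const z (n : ℝ)).div (hasDerivAt_id z) hz)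
    refine this.congr_deriv ?_
    simp only [id]
    field_simp
    ring
  have := (d1.mul h.dp).add ((hasDerivAt_const z ((n : ℝ) - 1)).div h.dy hy)
  refine this.congr_deriv ?_
  ring

theorem IsSol.p_neg_of_bend_eq_zero {n : ℕ} (hn : 2 ≤ n) {y p : ℝ → ℝ} {z : ℝ}
    (h : IsSol n y p z) (h0 : bend n z (y z) (p z) = 0) : p z < 0 := by
  have hz := h.zpos
  have hy := h.pos
  have hn' : (0 : ℝ) < n - 1 := by
    have : (2 : ℝ) ≤ n := by exact_mod_cast hn
    linarith
  by_contra hp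
  push Not at hp
  have : 0 < bend n z (y z) (p z) := by unfold bend; positivity
  linarith

theorem IsSol.deriv_bend_pos {n : ℕ} (hn : 2 ≤ n) {y p : ℝ → ℝ} {z : ℝ} (h : IsSol n y p z)
    (h0 : bend n z (y z) (p z) = 0) :
    0 < (-2 / z ^ 3 - n / z ^ 2) * p z +
        (1 / z ^ 2 + n / z) * ((1 + p z ^ 2) * bend n z (y z) (p z)) -
        ((n : ℝ) - 1) * p z / y z ^ 2 := by
  have hz := h.zpos
  have hy := h.pos
  have hn' : (0 : ℝ) < n - 1 := by
    have : (2 : ℝ) ≤ n := by exact_mod_cast hn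
    linarith
  have hp : 0 < -p z := neg_pos.2 (h.p_neg_of_bend_eq_zero hn h0)
  rw [h0]
  have : 0 < (2 / z ^ 3 + n / z ^ 2) * (-p z) + ((n : ℝ) - 1) * (-p z) / y z ^ 2 := by positivity
  refine this.trans_eq ?_
  ring

theorem IsMaxSol_s12.bend_pos_of_lt {n : ℕ} (hn : 2 ≤ n) {z₀ z₁ z₂ : ℝ} {I : Set ℝ} {y p : ℝ → ℝ}
    (h : IsMaxSol_s12 n z₀ I y p) (h1 : z₁ ∈ I) (h2 : z₂ ∈ I) (h12 : z₁ < z₂)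
    (hb : 0 ≤ bend n z₁ (y z₁) (p z₁)) : 0 < bend n z₂ (y z₂) (p z₂) :=
  pos_of_deriv_pos_of_eq_zero (f := fun t => bend n t (y t) (p t))
    (fun x hx => (h.sol x (h.ordConnected.out h1 h2 hx)).hasDerivAt_bend) hb
    (fun x hx h0 => (h.sol x (h.ordConnected.out h1 h2 hx)).deriv_bend_pos hn h0)
    z₂ ⟨h12, le_rfl⟩

theorem IsMaxSol_s12.exists_right_end {n : ℕ} {z₀ : ℝ} {I : Set ℝ} {y p : ℝ → ℝ}
    (h : IsMaxSol_s12 n z₀ I y p) (hI : ¬ Ici z₀ ⊆ I) : ∃ b, z₀ < b ∧ Ico z₀ b ⊆ I ∧ b ∉ I := by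
  have hne : (Ici z₀ ∩ Iᶜ).Nonempty := by
    obtain ⟨x, hx, hxI⟩ := not_subset.1 hI
    exact ⟨x, hx, hxI⟩
  have hbd : BddBelow (Ici z₀ ∩ Iᶜ) := ⟨z₀, fun x hx => hx.1⟩
  obtain ⟨hm, hm'⟩ := (isClosed_Ici.inter h.isOpen.isClosed_compl).csInf_mem hne hbd
  refine ⟨_, lt_of_le_of_ne hm fun he => hm' (he ▸ h.mem), fun x hx => ?_, hm'⟩
  by_contra hxI
  exact absurd (csInf_le hbd ⟨hx.1, hxI⟩) (not_le.2 hx.2)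

theorem IsMaxSol_s12.exists_left_end {n : ℕ} {z₀ : ℝ} {I : Set ℝ} {y p : ℝ → ℝ}
    (h : IsMaxSol_s12 n z₀ I y p) (hI : ¬ Ioc 0 z₀ ⊆ I) :
    ∃ a, 0 < a ∧ a < z₀ ∧ Ioc a z₀ ⊆ I ∧ a ∉ I := by
  obtain ⟨x, hx, hxI⟩ := not_subset.1 hI
  have hbd : BddAbove (Iic z₀ ∩ Iᶜ) := ⟨z₀, fun x hx => hx.1⟩
  have hmem : x ∈ Iic z₀ ∩ Iᶜ := ⟨hx.2, hxI⟩
  obtain ⟨hm, hm'⟩ := (isClosed_Iic.inter h.isOpen.isClosed_compl).csSup_mem ⟨x, hmem⟩ hbd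
  refine ⟨_, hx.1.trans_le (le_csSup hbd hmem),
    lt_of_le_of_ne hm fun he => hm' (mem_of_eq_of_mem he h.mem), fun t ht => ?_, hm'⟩
  by_contra htI
  exact absurd (le_csSup hbd ⟨ht.2, htI⟩) (not_le.2 ht.1)

theorem one_le_natCast_sub_one {n : ℕ} (hn : 2 ≤ n) : (1 : ℝ) ≤ n - 1 := by
  have : (2 : ℝ) ≤ n := by exact_mod_cast hn
  linarith

theorem le_one_add_sq_mul {a p x : ℝ} (h : a ≤ x) (hx : 0 ≤ x) : a ≤ (1 + p ^ 2) * x := by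
  nlinarith [mul_nonneg (sq_nonneg p) hx]

theorem IsMaxSol_s12.strictMonoOn_p {n : ℕ} {z₀ : ℝ} {I J : Set ℝ} {y p : ℝ → ℝ}
    (h : IsMaxSol_s12 n z₀ I y p) (hJ : Convex ℝ J) (hJI : J ⊆ I)
    (hb : ∀ z ∈ J, 0 < bend n z (y z) (p z)) : StrictMonoOn p J :=
  strictMonoOn_of_hasDerivAt_pos hJ (fun z hz => (h.sol z (hJI hz)).dp)
    (fun z hz => mul_pos (by positivity) (hb z hz))

theorem IsMaxSol_s12.monotoneOn_y {n : ℕ} {z₀ : ℝ} {I J : Set ℝ} {y p : ℝ → ℝ}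
    (h : IsMaxSol_s12 n z₀ I y p) (hJ : Convex ℝ J) (hJI : J ⊆ I)
    (hp : ∀ z ∈ J, 0 ≤ p z) : MonotoneOn y J :=
  monotoneOn_of_hasDerivAt_nonneg hJ (fun z hz => (h.sol z (hJI hz)).dy) hp

theorem IsMaxSol_s12.antitoneOn_y {n : ℕ} {z₀ : ℝ} {I J : Set ℝ} {y p : ℝ → ℝ}
    (h : IsMaxSol_s12 n z₀ I y p) (hJ : Convex ℝ J) (hJI : J ⊆ I)
    (hp : ∀ z ∈ J, p z ≤ 0) : AntitoneOn y J := by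
  have := monotoneOn_of_hasDerivAt_nonneg hJ (fun z hz => (h.sol z (hJI hz)).dy.neg)
    (fun z hz => neg_nonneg.2 (hp z hz))
  intro a ha b hb hab
  exact neg_le_neg_iff.1 (this ha hb hab)

theorem IsMaxSol_s12.exists_p_nonneg {n : ℕ} (hn : 2 ≤ n) {z₀ : ℝ} {I : Set ℝ} {y p : ℝ → ℝ}
    (h : IsMaxSol_s12 n z₀ I y p) (hb : ∀ z ∈ I, z₀ ≤ z → 0 < bend n z (y z) (p z)) :
    ∃ z ∈ I, z₀ ≤ z ∧ 0 ≤ p z := by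
  have hn1 := one_le_natCast_sub_one hn
  by_contra! hneg
  have hz0 := (h.sol z₀ h.mem).zpos
  have hy0 := (h.sol z₀ h.mem).pos
  have hJ : Convex ℝ (I ∩ Ici z₀) := (h.ordConnected.inter ordConnected_Ici).convex
  have hpm := h.strictMonoOn_p hJ inter_subset_left fun z hz => hb z hz.1 hz.2
  have hya := h.antitoneOn_y hJ inter_subset_left fun z hz => (hneg z hz.1 hz.2).le
  have m0 : z₀ ∈ I ∩ Ici z₀ := ⟨h.mem, self_mem_Ici⟩
  set q := -p z₀ with hq
  have hq0 : 0 < q := neg_pos.2 (hneg z₀ h.mem le_rfl)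
  have hpq : ∀ z ∈ I ∩ Ici z₀, -q ≤ p z := fun z hz => by
    have := hpm.monotoneOn m0 hz hz.2
    linarith
  have hr : ∀ z, z₀ ≤ z → 0 ≤ 1 / z ^ 2 + (n : ℝ) / z := fun z hz => by
    have : 0 < z := hz0.trans_le hz
    positivity
  by_cases hI : Ici z₀ ⊆ I
  · set c := ((n : ℝ) - 1) / y z₀ / 2 with hc
    have hc0 : 0 < c := by positivity
    have lim : Tendsto (fun z : ℝ => (1 / z ^ 2 + (n : ℝ) / z) * q) atTop (𝓝 0) := by
      have t1 : Tendsto (fun z : ℝ => 1 / z ^ 2) atTop (𝓝 0) :=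
        tendsto_const_nhds.div_atTop (tendsto_pow_atTop two_ne_zero)
      have t2 : Tendsto (fun z : ℝ => (n : ℝ) / z) atTop (𝓝 0) :=
        tendsto_const_nhds.div_atTop tendsto_id
      simpa using (t1.add t2).mul_const q
    obtain ⟨Z, hZ⟩ := eventually_atTop.1
      ((lim.eventually (gt_mem_nhds hc0)).and (eventually_ge_atTop z₀))
    have hZ0 : z₀ ≤ Z := (hZ Z le_rfl).2
    have hmono := monotoneOn_of_hasDerivAt_nonneg (convex_Ici Z)
      (f := fun z => p z - c * z) (fun z hz =>
        (h.sol z (hI (hZ0.trans hz))).dp.sub ((hasDerivAt_id z).const_mul c)) (fun z hz => by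
        have hz0' : z₀ ≤ z := hZ0.trans hz
        have hzm : z ∈ I ∩ Ici z₀ := ⟨hI hz0', hz0'⟩
        have h1 := hr z hz0'
        have h2 := mul_le_mul_of_nonneg_left (hpq z hzm) h1
        have h3 := (hZ z hz).1
        have h4 : ((n : ℝ) - 1) / y z₀ ≤ ((n : ℝ) - 1) / y z :=
          div_le_div_of_nonneg_left (by linarith) (h.sol z hzm.1).pos (hya m0 hzm hz0')
        have h5 : c ≤ bend n z (y z) (p z) := by
          unfold bend
          have : ((n : ℝ) - 1) / y z₀ = 2 * c := by rw [hc]; ring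
          linarith
        have := le_one_add_sq_mul (p := p z) h5 (hc0.le.trans h5)
        simp only [mul_one]
        linarith)
    have hw : Z ≤ Z + q / c := by
      have : 0 < q / c := by positivity
      linarith
    have h1 := hmono (self_mem_Ici) hw hw
    have h2 := hneg (Z + q / c) (hI (hZ0.trans hw)) (hZ0.trans hw)
    have h3 := hpq Z ⟨hI hZ0, hZ0⟩
    have h4 : c * (q / c) = q := by field_simp
    simp only [mul_add, h4] at h1
    linarith
  · obtain ⟨b, hb0, hbI, hbn⟩ := h.exists_right_end hI
    have hsub : ∀ z ∈ Ico z₀ b, z ∈ I ∩ Ici z₀ := fun z hz => ⟨hbI hz, hz.1⟩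
    have m0' : z₀ ∈ Ico z₀ b := ⟨le_rfl, hb0⟩
    set C := (1 + q ^ 2) * ((1 / z₀ ^ 2 + n / z₀) * q) with hC
    set k := ((n : ℝ) - 1) / q with hk
    have hk0 : 0 < k := by positivity
    have hmono := monotoneOn_of_hasDerivAt_nonneg (convex_Ico z₀ b)
      (f := fun z => p z + k * Real.log (y z) + C * z) (fun z hz =>
        ((h.sol z (hbI hz)).dp.add (((h.sol z (hbI hz)).dy.log
          (h.sol z (hbI hz)).pos.ne').const_mul k)).add
          ((hasDerivAt_id z).const_mul C)) (fun z hz => by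
        have hy := (h.sol z (hbI hz)).pos
        have hpz := hneg z (hbI hz) hz.1
        have hpq' := hpq z (hsub z hz)
        have hzz := hz0.trans_le hz.1
        have h1 : 1 / z ^ 2 + (n : ℝ) / z ≤ 1 / z₀ ^ 2 + n / z₀ := by
          have := hz.1
          gcongr
        have h2 : (1 / z ^ 2 + (n : ℝ) / z) * (-p z) ≤ (1 / z₀ ^ 2 + n / z₀) * q :=
          mul_le_mul h1 (by linarith) (by linarith) (hr _ le_rfl)
        have h3 : 1 + p z ^ 2 ≤ 1 + q ^ 2 := by nlinarith
        have h4 : (1 + p z ^ 2) * ((1 / z ^ 2 + (n : ℝ) / z) * (-p z)) ≤ C :=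
          mul_le_mul h3 h2 (mul_nonneg (hr z hz.1) (by linarith)) (by positivity)
        have h5 : ((n : ℝ) - 1) / y z ≤ (1 + p z ^ 2) * (((n : ℝ) - 1) / y z) :=
          le_one_add_sq_mul le_rfl (by positivity)
        have h6 : k * (-p z / y z) ≤ ((n : ℝ) - 1) / y z := by
          have : k * (-p z / y z) = ((n : ℝ) - 1) / y z * (-p z / q) := by
            rw [hk]; ring
          rw [this]
          refine mul_le_of_le_one_right (by positivity) ?_
          rw [div_le_one hq0]; linarith
        have h7 : (1 + p z ^ 2) * bend n z (y z) (p z) =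
          (1 + p z ^ 2) * (((n : ℝ) - 1) / y z) -
            (1 + p z ^ 2) * ((1 / z ^ 2 + (n : ℝ) / z) * (-p z)) := by unfold bend; ring
        have h8 : k * (p z / y z) = -(k * (-p z / y z)) := by ring
        rw [h7, h8, mul_one]
        linarith)
    have hC0 : 0 ≤ C := mul_nonneg (by positivity) (mul_nonneg (hr _ le_rfl) hq0.le)
    refine h.not_bounded_right hb0 hbI hbn (c := z₀) le_rfl hb0
      (m := Real.exp ((-q + k * Real.log (y z₀) - C * b) / k)) (M := q) (Real.exp_pos _)
      (fun z hz => ?_) (fun z hz => ?_)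
      (hpm.monotoneOn.mono fun z hz => hsub z ⟨hz.1.le, hz.2⟩)
    · have hz' : z ∈ Ico z₀ b := ⟨hz.1.le, hz.2⟩
      rw [← Real.le_log_iff_exp_le (h.sol z (hbI hz')).pos, div_le_iff₀ hk0]
      have h1 := hmono m0' hz' hz.1.le
      have h2 := hneg z (hbI hz') hz'.1
      have h3 := mul_le_mul_of_nonneg_left hz.2.le hC0
      have h4 := mul_nonneg hC0 hz0.le
      simp only at h1
      linarith
    · have hz' : z ∈ Ico z₀ b := ⟨hz.1.le, hz.2⟩
      have h2 := hneg z (hbI hz') hz'.1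
      exact abs_le.2 ⟨hpq z (hsub z hz'), by linarith⟩

theorem IsMaxSol_s12.exists_blowup {n : ℕ} (hn : 2 ≤ n) {z₀ : ℝ} {I : Set ℝ} {y p : ℝ → ℝ}
    (h : IsMaxSol_s12 n z₀ I y p) (hb : ∀ z ∈ I, z₀ ≤ z → 0 < bend n z (y z) (p z)) :
    ∃ b, z₀ < b ∧ Ico z₀ b ⊆ I ∧ Tendsto p (𝓝[<] b) atTop ∧
      ∃ L, 0 < L ∧ Tendsto y (𝓝[<] b) (𝓝 L) := by
  have hn1 := one_le_natCast_sub_one hn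
  have hn0 : (0 : ℝ) < n := by linarith
  have hz0 := (h.sol z₀ h.mem).zpos
  have hJ : Convex ℝ (I ∩ Ici z₀) := (h.ordConnected.inter ordConnected_Ici).convex
  have hpm := h.strictMonoOn_p hJ inter_subset_left fun z hz => hb z hz.1 hz.2
  obtain ⟨z₁, h1I, h01, hp1⟩ : ∃ z ∈ I, z₀ ≤ z ∧ 0 < p z := by
    obtain ⟨z, hzI, hz, hpz⟩ := h.exists_p_nonneg hn hb
    have hev : ∀ᶠ w in 𝓝[>] z, w ∈ I := nhdsWithin_le_nhds (h.isOpen.mem_nhds hzI)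
    obtain ⟨w, hwI, hw⟩ := (hev.and self_mem_nhdsWithin).exists
    exact ⟨w, hwI, hz.trans (le_of_lt hw),
      hpz.trans_lt (hpm ⟨hzI, hz⟩ ⟨hwI, hz.trans (le_of_lt hw)⟩ hw)⟩
  have hp : ∀ z ∈ I, z₁ ≤ z → p z₁ ≤ p z := fun z hz hz1 =>
    hpm.monotoneOn ⟨h1I, h01⟩ ⟨hz, h01.trans hz1⟩ hz1
  have hz1 : 0 < z₁ := hz0.trans_le h01
  have hbend : ∀ z ∈ I, z₁ ≤ z → n * p z / z ≤ bend n z (y z) (p z) := fun z hz hz1 => by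
    have h1 := (h.sol z hz).zpos
    have h2 := (h.sol z hz).pos
    have h3 := hp1.trans_le (hp z hz hz1)
    have : 0 ≤ 1 / z ^ 2 * p z + ((n : ℝ) - 1) / y z := by positivity
    have e : bend n z (y z) (p z) = n * p z / z + (1 / z ^ 2 * p z + ((n : ℝ) - 1) / y z) := by
      unfold bend; ring
    linarith
  have datan : ∀ z ∈ I, HasDerivAt (fun t => Real.arctan (p t)) (bend n z (y z) (p z)) z :=
    fun z hz => by
      refine (h.sol z hz).dp.arctan.congr_deriv ?_
      have : 1 + p z ^ 2 ≠ 0 := by positivity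
      field_simp
  have hIci : ¬ Ici z₀ ⊆ I := by
    intro hI
    set k := n * p z₁ with hk
    have hk0 : 0 < k := by positivity
    have hmono := monotoneOn_of_hasDerivAt_nonneg (convex_Ici z₁)
      (f := fun z => Real.arctan (p z) - k * Real.log z) (fun z hz =>
        (datan z (hI (h01.trans hz))).sub
          ((Real.hasDerivAt_log (hz1.trans_le hz).ne').const_mul k)) (fun z hz => by
        have hzI := hI (h01.trans hz)
        have hzp := hz1.trans_le hz
        have h1 := hbend z hzI hz
        have h2 : k * z⁻¹ ≤ n * p z / z := by
          rw [hk, ← div_eq_mul_inv]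
          have := hp z hzI hz
          gcongr
        linarith)
    have hpi := Real.pi_pos
    have hw : z₁ ≤ z₁ * Real.exp (Real.pi / k) :=
      le_mul_of_one_le_right hz1.le (Real.one_le_exp (by positivity))
    have h1 := hmono self_mem_Ici hw hw
    simp only at h1
    rw [Real.log_mul hz1.ne' (Real.exp_pos _).ne', Real.log_exp, mul_add,
      mul_div_cancel₀ _ hk0.ne'] at h1
    linarith [Real.arctan_lt_pi_div_two (p (z₁ * Real.exp (Real.pi / k))),
      Real.neg_pi_div_two_lt_arctan (p z₁)]
  obtain ⟨b, hb0, hbI, hbn⟩ := h.exists_right_end hIci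
  have h1b : z₁ < b := by
    by_contra! hle
    exact hbn (h.ordConnected.out h.mem h1I ⟨hb0.le, hle⟩)
  have hsub : Ico z₁ b ⊆ I := (Ico_subset_Ico_left h01).trans hbI
  have hym := h.monotoneOn_y (convex_Ico z₁ b) hsub
    fun z hz => hp1.le.trans (hp z (hsub hz) hz.1)
  have m1 : z₁ ∈ Ico z₁ b := ⟨le_rfl, h1b⟩
  have hbpos : 0 < b := hz0.trans hb0
  have hmono := monotoneOn_of_hasDerivAt_nonneg (convex_Ico z₁ b)
    (f := fun z => b / n * Real.arctan (p z) - y z) (fun z hz =>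
      ((datan z (hsub hz)).const_mul (b / n)).sub (h.sol z (hsub hz)).dy) (fun z hz => by
      have hzp := hz1.trans_le hz.1
      have hpz := hp1.trans_le (hp z (hsub hz) hz.1)
      have h2 : n * p z / b ≤ n * p z / z := by
        have := hz.2.le
        gcongr
      have h3 := mul_le_mul_of_nonneg_left (h2.trans (hbend z (hsub hz) hz.1))
        (show 0 ≤ b / n by positivity)
      have h4 : b / n * (n * p z / b) = p z := by field_simp
      linarith)
  have hyb : ∀ z ∈ Ico z₁ b, y z ≤ y z₁ + b / n * Real.pi := fun z hz => by
    have h1 := hmono m1 hz hz.1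
    have h2 : Real.arctan (p z) - Real.arctan (p z₁) ≤ Real.pi := by
      linarith [Real.arctan_lt_pi_div_two (p z), Real.neg_pi_div_two_lt_arctan (p z₁)]
    have h3 := mul_le_mul_of_nonneg_left h2 (show 0 ≤ b / n by positivity)
    simp only at h1
    linarith
  have hpm' : MonotoneOn p (Ioo z₁ b) := hpm.monotoneOn.mono fun z hz =>
    ⟨hsub ⟨hz.1.le, hz.2⟩, h01.trans hz.1.le⟩
  have tY := (hym.mono Ioo_subset_Ico_self).tendsto_nhdsWithin_Ioo_left (nonempty_Ioo.2 h1b)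
    ⟨y z₁ + b / n * Real.pi, by
      rintro _ ⟨z, hz, rfl⟩
      exact hyb z ⟨hz.1.le, hz.2⟩⟩
  refine ⟨b, hb0, hbI, ?_, _, ?_, tY⟩
  · rw [tendsto_atTop]
    intro K
    by_contra hK
    refine h.not_bounded_right hb0 hbI hbn h01 h1b (h.sol z₁ h1I).pos (M := K)
      (fun z hz => hym m1 ⟨hz.1.le, hz.2⟩ hz.1.le) (fun z hz => ?_) hpm'
    rw [abs_of_nonneg (hp1.le.trans (hp z (hsub ⟨hz.1.le, hz.2⟩) hz.1.le))]
    by_contra! hlt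
    refine hK ?_
    filter_upwards [Ioo_mem_nhdsLT hz.2] with t ht
    exact hlt.le.trans (hpm' hz ⟨hz.1.trans ht.1, ht.2⟩ ht.1.le)
  · refine (h.sol z₁ h1I).pos.trans_le (ge_of_tendsto tY ?_)
    filter_upwards [Ioo_mem_nhdsLT h1b] with t ht using hym m1 ⟨ht.1.le, ht.2⟩ ht.1.le

theorem IsMaxSol_s12.not_bend_pos_of_p_neg {n : ℕ} (hn : 2 ≤ n) {z₀ z₁ : ℝ} {I : Set ℝ}
    {y p : ℝ → ℝ} (h : IsMaxSol_s12 n z₀ I y p)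
    (hb : ∀ z ∈ I, z ≤ z₀ → 0 < bend n z (y z) (p z)) (h1I : z₁ ∈ I) (h10 : z₁ ≤ z₀)
    (hp1 : p z₁ < 0) : False := by
  have hn1 := one_le_natCast_sub_one hn
  have hz1 := (h.sol z₁ h1I).zpos
  have hy1 := (h.sol z₁ h1I).pos
  have hJ : Convex ℝ (I ∩ Iic z₁) := (h.ordConnected.inter ordConnected_Iic).convex
  have hpm := (h.strictMonoOn_p hJ inter_subset_left
    fun z hz => hb z hz.1 (hz.2.trans h10)).monotoneOn
  have m1 : z₁ ∈ I ∩ Iic z₁ := ⟨h1I, self_mem_Iic⟩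
  have hp : ∀ z ∈ I ∩ Iic z₁, p z ≤ p z₁ := fun z hz => hpm hz m1 hz.2
  have hya := h.antitoneOn_y hJ inter_subset_left fun z hz => (hp z hz).trans hp1.le
  have hpz : ∀ z ∈ I ∩ Iic z₁, -p z < ((n : ℝ) - 1) / y z₁ * z ^ 2 := fun z hz => by
    have hz0 := (h.sol z hz.1).zpos
    have hb' := hb z hz.1 (hz.2.trans h10)
    have h1 := hp z hz
    have h2 : ((n : ℝ) - 1) / y z ≤ ((n : ℝ) - 1) / y z₁ :=
      div_le_div_of_nonneg_left (by linarith) hy1 (hya hz m1 hz.2)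
    have h3 : 0 ≤ (n : ℝ) / z * (-p z) := mul_nonneg (by positivity) (by linarith)
    have h4 : -p z / z ^ 2 < ((n : ℝ) - 1) / y z₁ := by
      have e : bend n z (y z) (p z) =
        -(-p z / z ^ 2) - (n : ℝ) / z * (-p z) + ((n : ℝ) - 1) / y z := by unfold bend; ring
      linarith
    exact (div_lt_iff₀ (by positivity)).1 h4
  by_cases hI : Ioc 0 z₀ ⊆ I
  · set s := -p z₁ * y z₁ / ((n : ℝ) - 1) with hs
    have hs0 : 0 < s := div_pos (mul_pos (neg_pos.2 hp1) hy1) (by linarith)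
    set z := min z₁ (min 1 s) with hz
    have hz0 : 0 < z := lt_min hz1 (lt_min one_pos hs0)
    have hzz : z ≤ z₁ := min_le_left _ _
    have hz_one : z ≤ 1 := (min_le_right _ _).trans (min_le_left _ _)
    have hzs : z ≤ s := (min_le_right _ _).trans (min_le_right _ _)
    have hzJ : z ∈ I ∩ Iic z₁ := ⟨hI ⟨hz0, hzz.trans h10⟩, hzz⟩
    have h1 := hpz z hzJ
    have h2 := hp z hzJ
    have h3 : z ^ 2 ≤ s := by nlinarith
    have h4 : ((n : ℝ) - 1) / y z₁ * z ^ 2 ≤ ((n : ℝ) - 1) / y z₁ * s :=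
      mul_le_mul_of_nonneg_left h3 (by positivity)
    have h5 : ((n : ℝ) - 1) / y z₁ * s = -p z₁ := by
      have : (n : ℝ) - 1 ≠ 0 := by linarith
      rw [hs]; field_simp
    linarith
  · obtain ⟨a, ha0, ha, haI, han⟩ := h.exists_left_end hI
    have ha1 : a < z₁ := by
      by_contra! hle
      exact han (h.ordConnected.out h1I h.mem ⟨hle, ha.le⟩)
    have hsub : Ioo a z₁ ⊆ I ∩ Iic z₁ := fun z hz => ⟨haI ⟨hz.1, hz.2.le.trans h10⟩, hz.2.le⟩
    refine h.not_bounded_left ha0 ha haI han h10 ha1 hy1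
      (M := ((n : ℝ) - 1) / y z₁ * z₁ ^ 2) (fun z hz => hya (hsub hz) m1 hz.2.le)
      (fun z hz => ?_) (hpm.mono hsub)
    have h1 := hpz z (hsub hz)
    have h2 := hp z (hsub hz)
    rw [abs_of_nonpos (h2.trans hp1.le)]
    refine h1.le.trans (mul_le_mul_of_nonneg_left ?_ (by positivity))
    exact pow_le_pow_left₀ (ha0.trans hz.1).le hz.2.le 2

theorem IsMaxSol_s12.exists_p_neg {n : ℕ} (hn : 2 ≤ n) {z₀ : ℝ} {I : Set ℝ}
    {y p : ℝ → ℝ} (h : IsMaxSol_s12 n z₀ I y p)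
    (hb : ∀ z ∈ I, z ≤ z₀ → 0 < bend n z (y z) (p z)) : ∃ z ∈ I, z ≤ z₀ ∧ p z < 0 := by
  have hn1 := one_le_natCast_sub_one hn
  by_contra! hp
  have hz0 := (h.sol z₀ h.mem).zpos
  have hy0 := (h.sol z₀ h.mem).pos
  have hJ : Convex ℝ (I ∩ Iic z₀) := (h.ordConnected.inter ordConnected_Iic).convex
  have hpm := h.strictMonoOn_p hJ inter_subset_left fun z hz => hb z hz.1 hz.2
  have hym := h.monotoneOn_y hJ inter_subset_left fun z hz => hp z hz.1 hz.2
  have m0 : z₀ ∈ I ∩ Iic z₀ := ⟨h.mem, self_mem_Iic⟩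
  have hp0 : 0 < p z₀ := by
    have hev : ∀ᶠ w in 𝓝[<] z₀, w ∈ I := nhdsWithin_le_nhds (h.isOpen.mem_nhds h.mem)
    obtain ⟨w, hwI, hw⟩ := (hev.and self_mem_nhdsWithin).exists
    exact (hp w hwI (le_of_lt hw)).trans_lt (hpm ⟨hwI, le_of_lt hw⟩ m0 hw)
  by_cases hI : Ioc 0 z₀ ⊆ I
  · have hsub : ∀ z ∈ Ioc 0 z₀, z ∈ I ∩ Iic z₀ := fun z hz => ⟨hI hz, hz.2⟩
    set c := ((n : ℝ) - 1) / y z₀ with hc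
    have hc0 : 0 < c := by positivity
    have hacc : ∀ z ∈ Ioc 0 z₀, c + p z / z ^ 2 ≤ (1 + p z ^ 2) * bend n z (y z) (p z) :=
      fun z hz => by
        have hzp := hz.1
        have hpz := hp z (hI hz) hz.2
        have h1 : c ≤ ((n : ℝ) - 1) / y z :=
          div_le_div_of_nonneg_left (by linarith) (h.sol z (hI hz)).pos (hym (hsub z hz) m0 hz.2)
        have h2 : c + p z / z ^ 2 ≤ bend n z (y z) (p z) := by
          have e : bend n z (y z) (p z) = p z / z ^ 2 + n / z * p z + ((n : ℝ) - 1) / y z := by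
            unfold bend; ring
          have : 0 ≤ n / z * p z := by positivity
          linarith
        have h3 : 0 ≤ c + p z / z ^ 2 := by positivity
        exact le_one_add_sq_mul h2 (h3.trans h2)
    have hmono := monotoneOn_of_hasDerivAt_nonneg (convex_Ioc 0 z₀)
      (f := fun z => p z - c * z) (fun z hz =>
        (h.sol z (hI hz)).dp.sub ((hasDerivAt_id z).const_mul c)) (fun z hz => by
        have h1 := hacc z hz
        have h2 : 0 ≤ p z / z ^ 2 := div_nonneg (hp z (hI hz) hz.2) (by positivity)
        simp only [mul_one]
        linarith)
    have hlow : ∀ z ∈ Ioc 0 z₀, c / 2 * z ≤ p z := fun z hz => by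
      have hz2 : z / 2 ∈ Ioc 0 z₀ := ⟨half_pos hz.1, by linarith [hz.1, hz.2]⟩
      have h1 := hmono hz2 hz (by linarith [hz.1])
      have h2 := hp _ (hI hz2) hz2.2
      simp only at h1
      linarith
    have hmono' := monotoneOn_of_hasDerivAt_nonneg (convex_Ioc 0 z₀)
      (f := fun z => p z - c / 2 * Real.log z) (fun z hz =>
        (h.sol z (hI hz)).dp.sub ((Real.hasDerivAt_log hz.1.ne').const_mul (c / 2)))
        (fun z hz => by
        have hzp := hz.1
        have h1 := hacc z hz
        have h2 : c / 2 * z⁻¹ ≤ p z / z ^ 2 := by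
          rw [le_div_iff₀ (by positivity)]
          have e : c / 2 * z⁻¹ * z ^ 2 = c / 2 * z := by field_simp
          rw [e]
          exact hlow z hz
        linarith)
    have hw0 : 0 < z₀ * Real.exp (-(2 * p z₀ / c + 1)) := by positivity
    have hw1 : z₀ * Real.exp (-(2 * p z₀ / c + 1)) ≤ z₀ := by
      refine mul_le_of_le_one_right hz0.le (Real.exp_le_one_iff.2 ?_)
      have : 0 < 2 * p z₀ / c := by positivity
      linarith
    have h1 := hmono' ⟨hw0, hw1⟩ ⟨hz0, le_rfl⟩ hw1
    have h2 := hp _ (hI ⟨hw0, hw1⟩) hw1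
    simp only at h1
    rw [Real.log_mul hz0.ne' (Real.exp_pos _).ne', Real.log_exp] at h1
    have h3 : c / 2 * (2 * p z₀ / c) = p z₀ := by field_simp
    linarith
  · obtain ⟨a, ha0, ha, haI, han⟩ := h.exists_left_end hI
    have hsub : ∀ z ∈ Ioc a z₀, z ∈ I ∩ Iic z₀ := fun z hz => ⟨haI hz, hz.2⟩
    set k := ((n : ℝ) - 1) / p z₀ with hk
    have hk0 : 0 < k := by positivity
    have hmono := monotoneOn_of_hasDerivAt_nonneg (convex_Ioc a z₀)
      (f := fun z => p z - k * Real.log (y z)) (fun z hz =>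
        (h.sol z (haI hz)).dp.sub (((h.sol z (haI hz)).dy.log
          (h.sol z (haI hz)).pos.ne').const_mul k)) (fun z hz => by
        have hy := (h.sol z (haI hz)).pos
        have hzp := (h.sol z (haI hz)).zpos
        have hpz := hp z (haI hz) hz.2
        have hpp := hpm.monotoneOn (hsub z hz) m0 hz.2
        have h1 : ((n : ℝ) - 1) / y z ≤ bend n z (y z) (p z) := by
          unfold bend
          have : 0 ≤ (1 / z ^ 2 + n / z) * p z := by positivity
          linarith
        have h2 := le_one_add_sq_mul (p := p z) h1 (le_trans (by positivity) h1)
        have h3 : k * (p z / y z) ≤ ((n : ℝ) - 1) / y z := by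
          have : k * (p z / y z) = ((n : ℝ) - 1) / y z * (p z / p z₀) := by
            rw [hk]; ring
          rw [this]
          refine mul_le_of_le_one_right (by positivity) ?_
          rwa [div_le_one hp0]
        linarith)
    refine h.not_bounded_left ha0 ha haI han le_rfl ha
      (m := Real.exp ((k * Real.log (y z₀) - p z₀) / k)) (M := p z₀) (Real.exp_pos _)
      (fun z hz => ?_) (fun z hz => ?_)
      (hpm.monotoneOn.mono fun z hz => hsub z ⟨hz.1, hz.2.le⟩)
    · have hz' : z ∈ Ioc a z₀ := ⟨hz.1, hz.2.le⟩
      rw [← Real.le_log_iff_exp_le (h.sol z (haI hz')).pos, div_le_iff₀ hk0]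
      have h1 := hmono hz' ⟨ha, le_rfl⟩ hz.2.le
      have h2 := hp z (haI hz') hz'.2
      simp only at h1
      linarith
    · have hz' : z ∈ Ioc a z₀ := ⟨hz.1, hz.2.le⟩
      rw [abs_of_nonneg (hp z (haI hz') hz'.2)]
      exact hpm.monotoneOn (hsub z hz') m0 hz'.2

theorem IsMaxSol_s12.exists_bend_eq_zero {n : ℕ} (hn : 2 ≤ n) {z₀ : ℝ} {I : Set ℝ}
    {y p : ℝ → ℝ} (h : IsMaxSol_s12 n z₀ I y p) (hb₀ : 0 < bend n z₀ (y z₀) (p z₀)) :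
    ∃ z ∈ I, z < z₀ ∧ bend n z (y z) (p z) = 0 := by
  by_contra! hne
  have hb : ∀ z ∈ I, z ≤ z₀ → 0 < bend n z (y z) (p z) := by
    intro z hz hz0
    by_contra! hle
    obtain ⟨w, hw, hw0⟩ := intermediate_value_Icc hz0
      (f := fun t => bend n t (y t) (p t)) (fun t ht =>
        (h.sol t (h.ordConnected.out hz h.mem ht)).hasDerivAt_bend.continuousAt.continuousWithinAt)
      ⟨hle, hb₀.le⟩
    refine hne w (h.ordConnected.out hz h.mem hw) (lt_of_le_of_ne hw.2 ?_) hw0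
    rintro rfl
    exact hb₀.ne' hw0
  obtain ⟨z₁, h1I, h10, hp1⟩ := h.exists_p_neg hn hb
  exact h.not_bend_pos_of_p_neg hn hb h1I h10 hp1

theorem rotODE_iff_deriv_deriv_eq {n : ℕ} {φ : ℝ → ℝ} {z : ℝ} (hz : 0 < z) :
    RotODE n φ z ↔
      deriv (deriv φ) z = (1 + deriv φ z ^ 2) * bend n z (φ z) (deriv φ z) := by
  have hq : 1 + deriv φ z ^ 2 ≠ 0 := by positivity
  have e : z * deriv (deriv φ) z / (1 + (deriv φ z) ^ 2) -
      ((1 + (n : ℝ) * z) / z) * deriv φ z - ((n : ℝ) - 1) * z / φ z =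
      z / (1 + deriv φ z ^ 2) *
        (deriv (deriv φ) z - (1 + deriv φ z ^ 2) * bend n z (φ z) (deriv φ z)) := by
    have e1 : z / (1 + deriv φ z ^ 2) *
        (deriv (deriv φ) z - (1 + deriv φ z ^ 2) * bend n z (φ z) (deriv φ z)) =
        z * deriv (deriv φ) z / (1 + (deriv φ z) ^ 2) - z * bend n z (φ z) (deriv φ z) := by
      field_simp
    have e2 : z * bend n z (φ z) (deriv φ z) =
        ((1 + (n : ℝ) * z) / z) * deriv φ z + ((n : ℝ) - 1) * z / φ z := by
      have : z * (1 / z ^ 2 + (n : ℝ) / z) = (1 + (n : ℝ) * z) / z := by field_simp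
      unfold bend
      rw [mul_add, ← mul_assoc, this]
      ring
    rw [e1, e2]
    ring
  unfold RotODE
  rw [e, mul_eq_zero, or_iff_right (div_pos hz (by positivity)).ne', sub_eq_zero]

theorem isSol_deriv {n : ℕ} {φ : ℝ → ℝ} {z : ℝ} (hz : 0 < z) (hφ : ContDiffAt ℝ 2 φ z)
    (hpos : 0 < φ z) (hode : RotODE n φ z) : IsSol n φ (deriv φ) z := by
  refine ⟨hz, hpos, (hφ.differentiableAt (by norm_num)).hasDerivAt, ?_⟩
  have hd : DifferentiableAt ℝ (deriv φ) z := by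
    have h1 : ContDiffAt ℝ 1 (fderiv ℝ φ) z := hφ.fderiv_right (by norm_num)
    exact (h1.differentiableAt (by norm_num)).clm_apply (differentiableAt_const (1 : ℝ))
  rw [← (rotODE_iff_deriv_deriv_eq hz).1 hode]
  exact hd.hasDerivAt

section OpenSet

variable {n : ℕ} {y p : ℝ → ℝ} {I : Set ℝ} {z : ℝ}

theorem IsSol.deriv_deriv_eq (hI : IsOpen I) (h : ∀ z ∈ I, IsSol n y p z) (hz : z ∈ I) :
    deriv (deriv y) z = (1 + p z ^ 2) * bend n z (y z) (p z) := by
  have : deriv y =ᶠ[𝓝 z] p := by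
    filter_upwards [hI.mem_nhds hz] with t ht using (h t ht).dy.deriv
  rw [this.deriv_eq, (h z hz).dp.deriv]

theorem IsSol.rotODE (hI : IsOpen I) (h : ∀ z ∈ I, IsSol n y p z) (hz : z ∈ I) :
    RotODE n y z := by
  rw [rotODE_iff_deriv_deriv_eq (h z hz).zpos, IsSol.deriv_deriv_eq hI h hz, (h z hz).dy.deriv]

theorem IsSol.contDiffAt (hI : IsOpen I) (h : ∀ z ∈ I, IsSol n y p z) (hz : z ∈ I) :
    ContDiffAt ℝ 2 y z := by
  have hp : ContDiffOn ℝ (0 + 1) p I := by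
    rw [contDiffOn_succ_iff_deriv_of_isOpen hI, contDiffOn_zero]
    refine ⟨fun t ht => (h t ht).dp.differentiableAt.differentiableWithinAt, by simp, ?_⟩
    refine ContinuousOn.congr (f := fun t => (1 + p t ^ 2) * bend n t (y t) (p t))
      (fun t ht => ?_) fun t ht => (h t ht).dp.deriv
    exact (((h t ht).dp.continuousAt.pow 2).const_add 1 |>.mul
      (h t ht).hasDerivAt_bend.continuousAt).continuousWithinAt
  rw [zero_add] at hp
  have hy : ContDiffOn ℝ (1 + 1) y I := by
    rw [contDiffOn_succ_iff_deriv_of_isOpen hI]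
    exact ⟨fun t ht => (h t ht).dy.differentiableAt.differentiableWithinAt, by simp,
      hp.congr fun t ht => (h t ht).dy.deriv⟩
  rw [one_add_one_eq_two] at hy
  exact hy.contDiffAt (hI.mem_nhds hz)

end OpenSet

theorem existsUnique_isMinOn {y p : ℝ → ℝ} {a b : ℝ} (hab : a < b)
    (hy : ∀ z ∈ Ico a b, HasDerivAt y (p z) z) (hpc : ContinuousOn p (Ico a b))
    (hp : StrictMonoOn p (Ico a b)) (hpa : p a < 0) (hpb : Tendsto p (𝓝[<] b) atTop) :
    ∃! zm, zm ∈ Ioo a b ∧ IsMinOn y (Ioo a b) zm := by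
  obtain ⟨c, hcp, hc⟩ := ((hpb.eventually_gt_atTop 0).and (Ioo_mem_nhdsLT hab)).exists
  obtain ⟨zm, hzm, hzm0⟩ := intermediate_value_Icc hc.1.le
    (hpc.mono fun t ht => ⟨ht.1, ht.2.trans_lt hc.2⟩) ⟨hpa.le, hcp.le⟩
  have ham : a < zm := lt_of_le_of_ne hzm.1 fun he => by
    subst he
    exact hpa.ne hzm0
  have hmb : zm < b := hzm.2.trans_lt hc.2
  have mm : zm ∈ Ico a b := ⟨ham.le, hmb⟩
  have right : MonotoneOn y (Ico zm b) :=
    monotoneOn_of_hasDerivAt_nonneg (convex_Ico zm b)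
      (fun z hz => hy z ⟨ham.le.trans hz.1, hz.2⟩)
      fun z hz => hzm0 ▸ hp.monotoneOn mm ⟨ham.le.trans hz.1, hz.2⟩ hz.1
  have left : MonotoneOn (fun z => -y z) (Icc a zm) :=
    monotoneOn_of_hasDerivAt_nonneg (convex_Icc a zm)
      (fun z hz => (hy z ⟨hz.1, hz.2.trans_lt hmb⟩).neg)
      fun z hz => neg_nonneg.2 (hzm0 ▸ hp.monotoneOn ⟨hz.1, hz.2.trans_lt hmb⟩ mm hz.2)
  refine ⟨zm, ⟨⟨ham, hmb⟩, fun z hz => ?_⟩, ?_⟩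
  · rcases le_total z zm with hle | hle
    · exact neg_le_neg_iff.1 (left ⟨hz.1.le, hle⟩ ⟨ham.le, le_rfl⟩ hle)
    · exact right ⟨le_rfl, hmb⟩ ⟨hle, hz.2⟩ hle
  · rintro w ⟨hw, hwmin⟩
    have hw' : w ∈ Ico a b := ⟨hw.1.le, hw.2⟩
    have h0 := (hwmin.isLocalMin (isOpen_Ioo.mem_nhds hw)).hasDerivAt_eq_zero (hy w hw')
    exact hp.injOn hw' mm (h0.trans hzm0.symm)

/-- convex branch, Lemma 3.6(2): a positive solution of the rotational
soliton ODE near `z₀ > 0` with `φ'(z₀) ≥ 0` or `φ''(z₀) > 0` extends to a positive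
solution on `[λ₀,h)` ∋ `z₀` with `φ'' > 0` on `(λ₀,h)`, `φ'(λ₀) < 0`, `φ''(λ₀) = 0`,
`φ` tends to a finite positive limit and `φ' → +∞` at `h⁻`, and `φ` has a unique
minimum on `(λ₀,h)`. -/
theorem rot_soliton_convex_branch (n : ℕ) (hn : 2 ≤ n) (z₀ : ℝ) (hz₀ : 0 < z₀)
    (φ : ℝ → ℝ)
    (hnb : ∀ᶠ z in 𝓝 z₀, ContDiffAt ℝ 2 φ z ∧ 0 < φ z ∧ RotODE n φ z)
    (hd : 0 ≤ deriv φ z₀ ∨ 0 < deriv (deriv φ) z₀) :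
    ∃ lam h : ℝ, 0 < lam ∧ lam < h ∧ z₀ ∈ Set.Ioo lam h ∧
      ∃ ψ : ℝ → ℝ, ψ =ᶠ[𝓝 z₀] φ ∧
        (∀ z ∈ Set.Ico lam h, ContDiffAt ℝ 2 ψ z ∧ 0 < ψ z ∧ RotODE n ψ z) ∧
        (∀ z ∈ Set.Ioo lam h, 0 < deriv (deriv ψ) z) ∧
        deriv ψ lam < 0 ∧ deriv (deriv ψ) lam = 0 ∧
        (∃ L : ℝ, 0 < L ∧ Tendsto ψ (𝓝[<] h) (𝓝 L)) ∧
        Tendsto (deriv ψ) (𝓝[<] h) atTop ∧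
        ∃! zm : ℝ, zm ∈ Set.Ioo lam h ∧ IsMinOn ψ (Set.Ioo lam h) zm := by
  have hsol : ∀ᶠ z in 𝓝 z₀, IsSol n φ (deriv φ) z := by
    filter_upwards [hnb, lt_mem_nhds hz₀] with z hz hz0
    exact isSol_deriv hz0 hz.1 hz.2.1 hz.2.2
  have hb₀ : 0 < bend n z₀ (φ z₀) (deriv φ z₀) := by
    obtain ⟨-, hpos, hode⟩ := hnb.self_of_nhds
    rcases hd with hd | hd
    · by_contra! hle
      have hn1 := one_le_natCast_sub_one hn
      have : 0 < bend n z₀ (φ z₀) (deriv φ z₀) := by unfold bend; positivity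
      linarith
    · rw [(rotODE_iff_deriv_deriv_eq hz₀).1 hode] at hd
      exact pos_of_mul_pos_right hd (by positivity)
  obtain ⟨I, y, p, hM, heq⟩ := exists_isMaxSol hsol
  obtain ⟨ey, ep⟩ := heq.self_of_nhds
  rw [← ey, ← ep] at hb₀
  obtain ⟨lam, hlI, hl0, hlb⟩ := hM.exists_bend_eq_zero hn hb₀
  have hbend : ∀ z ∈ I, lam < z → 0 < bend n z (y z) (p z) := fun z hz hlz =>
    hM.bend_pos_of_lt hn hlI hz hlz hlb.ge
  obtain ⟨h, hh, hhI, tp, L, hL, ty⟩ :=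
    hM.exists_blowup hn fun z hz hz0 => hbend z hz (hl0.trans_le hz0)
  have hlh : lam < h := hl0.trans hh
  have hsub : Ico lam h ⊆ I := fun z hz => by
    rcases le_total z z₀ with hle | hle
    · exact hM.ordConnected.out hlI hM.mem ⟨hz.1, hle⟩
    · exact hhI ⟨hle, hz.2⟩
  have hpl := (hM.sol lam hlI).p_neg_of_bend_eq_zero hn hlb
  have hpc : ContinuousOn p (Ico lam h) := fun z hz =>
    (hM.sol z (hsub hz)).dp.continuousAt.continuousWithinAt
  have hp : StrictMonoOn p (Ico lam h) := by
    refine strictMonoOn_of_hasDerivWithinAt_pos (convex_Ico lam h) hpc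
      (fun z hz => (hM.sol z (hsub (interior_subset hz))).dp.hasDerivWithinAt) fun z hz => ?_
    have hz' := interior_subset hz
    rw [interior_Ico] at hz
    exact mul_pos (by positivity) (hbend z (hsub hz') hz.1)
  refine ⟨lam, h, (hM.sol lam hlI).zpos, hlh, ⟨hl0, hh⟩, y, heq.mono fun z hz => hz.1,
    fun z hz => ⟨IsSol.contDiffAt hM.isOpen hM.sol (hsub hz), (hM.sol z (hsub hz)).pos,
      IsSol.rotODE hM.isOpen hM.sol (hsub hz)⟩, fun z hz => ?_, ?_, ?_, ⟨L, hL, ty⟩, ?_,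
    existsUnique_isMinOn hlh (fun z hz => (hM.sol z (hsub hz)).dy) hpc hp hpl tp⟩
  · have hzI := hsub ⟨hz.1.le, hz.2⟩
    rw [IsSol.deriv_deriv_eq hM.isOpen hM.sol hzI]
    exact mul_pos (by positivity) (hbend z hzI hz.1)
  · rwa [(hM.sol lam hlI).dy.deriv]
  · rw [IsSol.deriv_deriv_eq hM.isOpen hM.sol hlI, hlb, mul_zero]
  · refine tp.congr' ?_
    filter_upwards [Ioo_mem_nhdsLT hlh] with z hz
    exact (hM.sol z (hsub ⟨hz.1.le, hz.2⟩)).dy.deriv.symm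
end

section
/- Let n ≥ 2, let 0 ≤ r₁ < r₂, and let u₁, u₂ be positive C² solutions on (r₁, r₂) of the rotational soliton ODE u''/(1+(u')²) + ((n−1)/ρ)·u' = −(1+nu)/u². Then either u₁ ≡ u₂ on (r₁, r₂), or the function u₁ − u₂ does not attain a non-negative local maximum at any point of (r₁, r₂). -/
open Set Filter Topology

/-- The rotational soliton ODE in radial graph form:
`u''/(1+(u')²) + ((n−1)/ρ)·u' = −(1+nu)/u²` at `ρ`. -/
def RadODE (n : ℕ) (u : ℝ → ℝ) (ρ : ℝ) : Prop :=
  deriv (deriv u) ρ / (1 + (deriv u ρ) ^ 2) + (((n : ℝ) - 1) / ρ) * deriv u ρ =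
    -(1 + (n : ℝ) * u ρ) / (u ρ) ^ 2

/-- A solution of a homogeneous linear second-order equation with continuous coefficients that
vanishes to first order at a point of an interval vanishes on the whole interval. -/
theorem eq_zero_of_linear_second_order {a b t₀ : ℝ} {A B w p : ℝ → ℝ}
    (ht₀ : t₀ ∈ Ioo a b) (hA : ContinuousOn A (Ioo a b)) (hB : ContinuousOn B (Ioo a b))
    (hw : ∀ t ∈ Ioo a b, HasDerivAt w (p t) t)
    (hp : ∀ t ∈ Ioo a b, HasDerivAt p (A t * p t + B t * w t) t)
    (hw₀ : w t₀ = 0) (hp₀ : p t₀ = 0) : ∀ t ∈ Ioo a b, w t = 0 := by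
  intro t ht
  obtain ⟨c, hac, hc⟩ := exists_between (lt_min ht₀.1 ht.1)
  obtain ⟨d, hd, hdb⟩ := exists_between (max_lt ht₀.2 ht.2)
  obtain ⟨hc₀, hct⟩ := lt_min_iff.1 hc
  obtain ⟨hd₀, hdt⟩ := max_lt_iff.1 hd
  have hsub : Icc c d ⊆ Ioo a b := Icc_subset_Ioo hac hdb
  obtain ⟨M, hM⟩ := isCompact_Icc.exists_bound_of_continuousOn (hA.mono hsub)
  obtain ⟨N, hN⟩ := isCompact_Icc.exists_bound_of_continuousOn (hB.mono hsub)
  have hM0 : 0 ≤ M := (norm_nonneg _).trans (hM t₀ ⟨hc₀.le, hd₀.le⟩)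
  have hN0 : 0 ≤ N := (norm_nonneg _).trans (hN t₀ ⟨hc₀.le, hd₀.le⟩)
  have hK : 0 ≤ 1 + M + N := by positivity
  have hlip : ∀ s ∈ Ioo c d, LipschitzOnWith ⟨1 + M + N, hK⟩
      (fun y : ℝ × ℝ => (y.2, A s * y.2 + B s * y.1)) univ := by
    intro s hs
    refine LipschitzOnWith.of_dist_le_mul fun y _ z _ => ?_
    have hs' := Ioo_subset_Icc_self hs
    have h1 : |y.1 - z.1| ≤ dist y z := by
      rw [Prod.dist_eq, Real.dist_eq]; exact le_max_left _ _
    have h2 : |y.2 - z.2| ≤ dist y z := by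
      rw [Prod.dist_eq, Real.dist_eq y.2]; exact le_max_right _ _
    have hd0 : 0 ≤ dist y z := dist_nonneg
    have h3 : |A s| * |y.2 - z.2| ≤ M * dist y z :=
      mul_le_mul (hM s hs') h2 (abs_nonneg _) hM0
    have h4 : |B s| * |y.1 - z.1| ≤ N * dist y z :=
      mul_le_mul (hN s hs') h1 (abs_nonneg _) hN0
    change _ ≤ (1 + M + N) * dist y z
    rw [Prod.dist_eq (x := (y.2, _)), Real.dist_eq, Real.dist_eq]
    refine max_le (by nlinarith) ?_
    calc |A s * y.2 + B s * y.1 - (A s * z.2 + B s * z.1)|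
        = |A s * (y.2 - z.2) + B s * (y.1 - z.1)| := by ring_nf
      _ ≤ |A s| * |y.2 - z.2| + |B s| * |y.1 - z.1| := by
          simpa only [abs_mul] using abs_add_le (A s * (y.2 - z.2)) (B s * (y.1 - z.1))
      _ ≤ (1 + M + N) * dist y z := by nlinarith
  have huniq := ODE_solution_unique_of_mem_Ioo (f := fun s => (w s, p s))
    (g := fun _ => (0, 0)) hlip ⟨hc₀, hd₀⟩
    (fun s hs => ⟨(hw s (hsub (Ioo_subset_Icc_self hs))).prodMk
      (hp s (hsub (Ioo_subset_Icc_self hs))), mem_univ _⟩)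
    (fun s _ => ⟨by simpa [← Prod.zero_eq_mk] using hasDerivAt_const s (0 : ℝ × ℝ), mem_univ _⟩)
    (by simp [hw₀, hp₀])
  exact congrArg Prod.fst (huniq ⟨hct, hdt⟩)

/-- A local maximum cannot be a critical point with positive second derivative. -/
theorem IsLocalMax.deriv_deriv_nonpos {f : ℝ → ℝ} {x : ℝ} (h : IsLocalMax f x)
    (hf : ContinuousAt f x) : deriv (deriv f) x ≤ 0 := by
  by_contra! hpos
  have hmin := isLocalMin_of_deriv_deriv_pos hpos h.deriv_eq_zero hf
  have hconst : f =ᶠ[𝓝 x] fun _ => f x := by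
    filter_upwards [h, hmin] with y h₁ h₂ using le_antisymm h₁ h₂
  have h0 : deriv (deriv f) x = 0 := by
    rw [hconst.deriv.deriv_eq]
    simp
  exact hpos.ne' h0

/-- The radial equation solved for the second derivative. -/
theorem RadODE.deriv_deriv_eq {n : ℕ} {u : ℝ → ℝ} {ρ : ℝ} (h : RadODE n u ρ) :
    deriv (deriv u) ρ = (1 + deriv u ρ ^ 2) *
      (-(1 + (n : ℝ) * u ρ) / u ρ ^ 2 - ((n : ℝ) - 1) / ρ * deriv u ρ) := by
  have hne : 1 + deriv u ρ ^ 2 ≠ 0 := by positivity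
  rw [← (h : _ = _), add_sub_cancel_right, mul_div_cancel₀ _ hne]

/-- Lemma 3.7: two positive solutions of the radial rotational soliton
ODE on `(r₁,r₂)` either coincide, or their difference attains no non-negative local
maximum on `(r₁,r₂)`. -/
theorem rot_soliton_max_principle (n : ℕ) (hn : 2 ≤ n)
    (r₁ r₂ : ℝ) (hr₁ : 0 ≤ r₁) (hr : r₁ < r₂)
    (u₁ u₂ : ℝ → ℝ)
    (hreg₁ : ∀ ρ ∈ Set.Ioo r₁ r₂, ContDiffAt ℝ 2 u₁ ρ)
    (hreg₂ : ∀ ρ ∈ Set.Ioo r₁ r₂, ContDiffAt ℝ 2 u₂ ρ)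
    (hpos₁ : ∀ ρ ∈ Set.Ioo r₁ r₂, 0 < u₁ ρ)
    (hpos₂ : ∀ ρ ∈ Set.Ioo r₁ r₂, 0 < u₂ ρ)
    (hode₁ : ∀ ρ ∈ Set.Ioo r₁ r₂, RadODE n u₁ ρ)
    (hode₂ : ∀ ρ ∈ Set.Ioo r₁ r₂, RadODE n u₂ ρ) :
    (∀ ρ ∈ Set.Ioo r₁ r₂, u₁ ρ = u₂ ρ) ∨
      ¬ ∃ ρ₀ ∈ Set.Ioo r₁ r₂, 0 ≤ u₁ ρ₀ - u₂ ρ₀ ∧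
          IsLocalMaxOn (fun ρ => u₁ ρ - u₂ ρ) (Set.Ioo r₁ r₂) ρ₀ := by
  refine or_iff_not_imp_right.2 fun hmax => ?_
  obtain ⟨t₀, ht₀, hnn, hloc⟩ := not_not.1 hmax
  have hmax : IsLocalMax (fun ρ => u₁ ρ - u₂ ρ) t₀ := hloc.isLocalMax (Ioo_mem_nhds ht₀.1 ht₀.2)
  have hd₁ : ∀ t ∈ Ioo r₁ r₂, HasDerivAt u₁ (deriv u₁ t) t := fun t ht =>
    ((hreg₁ t ht).differentiableAt (by norm_num)).hasDerivAt
  have hd₂ : ∀ t ∈ Ioo r₁ r₂, HasDerivAt u₂ (deriv u₂ t) t := fun t ht =>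
    ((hreg₂ t ht).differentiableAt (by norm_num)).hasDerivAt
  have hdd₁ : ∀ t ∈ Ioo r₁ r₂, HasDerivAt (deriv u₁) (deriv (deriv u₁) t) t := fun t ht =>
    (((hreg₁ t ht).derivWithin (m := 1) (by norm_num)).differentiableAt (by norm_num)).hasDerivAt
  have hdd₂ : ∀ t ∈ Ioo r₁ r₂, HasDerivAt (deriv u₂) (deriv (deriv u₂) t) t := fun t ht =>
    (((hreg₂ t ht).derivWithin (m := 1) (by norm_num)).differentiableAt (by norm_num)).hasDerivAt
  have hcu₁ : ContinuousOn u₁ (Ioo r₁ r₂) := fun t ht => (hd₁ t ht).continuousAt.continuousWithinAt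
  have hcu₂ : ContinuousOn u₂ (Ioo r₁ r₂) := fun t ht => (hd₂ t ht).continuousAt.continuousWithinAt
  have hcp₁ : ContinuousOn (deriv u₁) (Ioo r₁ r₂) :=
    fun t ht => (hdd₁ t ht).continuousAt.continuousWithinAt
  have hcp₂ : ContinuousOn (deriv u₂) (Ioo r₁ r₂) :=
    fun t ht => (hdd₂ t ht).continuousAt.continuousWithinAt
  have hne : ∀ t ∈ Ioo r₁ r₂, t ≠ 0 := fun t ht => (hr₁.trans_lt ht.1).ne'
  have hne₁ : ∀ t ∈ Ioo r₁ r₂, u₁ t ≠ 0 := fun t ht => (hpos₁ t ht).ne'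
  have hne₂ : ∀ t ∈ Ioo r₁ r₂, u₂ t ≠ 0 := fun t ht => (hpos₂ t ht).ne'
  -- The difference of the two solutions solves a homogeneous linear equation.
  let A : ℝ → ℝ := fun t => (deriv u₁ t + deriv u₂ t) *
      (-(1 + (n : ℝ) * u₁ t) / u₁ t ^ 2 - ((n : ℝ) - 1) / t * deriv u₁ t) -
    (1 + deriv u₂ t ^ 2) * (((n : ℝ) - 1) / t)
  let B : ℝ → ℝ := fun t => (1 + deriv u₂ t ^ 2) *
    ((u₁ t + u₂ t + n * u₁ t * u₂ t) / (u₁ t ^ 2 * u₂ t ^ 2))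
  have hA : ContinuousOn A (Ioo r₁ r₂) := by
    have h₁ : ContinuousOn (fun t => -(1 + (n : ℝ) * u₁ t) / u₁ t ^ 2) (Ioo r₁ r₂) :=
      ContinuousOn.div (by fun_prop) (by fun_prop) fun t ht => pow_ne_zero 2 (hne₁ t ht)
    have h₂ : ContinuousOn (fun t : ℝ => ((n : ℝ) - 1) / t) (Ioo r₁ r₂) :=
      continuousOn_const.div continuousOn_id hne
    exact ((hcp₁.add hcp₂).mul (h₁.sub (h₂.mul hcp₁))).sub
      ((continuousOn_const.add (hcp₂.pow 2)).mul h₂)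
  have hB : ContinuousOn B (Ioo r₁ r₂) :=
    (continuousOn_const.add (hcp₂.pow 2)).mul <| ContinuousOn.div (by fun_prop) (by fun_prop)
      fun t ht => mul_ne_zero (pow_ne_zero 2 (hne₁ t ht)) (pow_ne_zero 2 (hne₂ t ht))
  have hlin : ∀ t ∈ Ioo r₁ r₂, deriv (deriv u₁) t - deriv (deriv u₂) t =
      A t * (deriv u₁ t - deriv u₂ t) + B t * (u₁ t - u₂ t) := by
    intro t ht
    have h₀ := hne t ht
    have h₁ := hne₁ t ht
    have h₂ := hne₂ t ht
    rw [(hode₁ t ht).deriv_deriv_eq, (hode₂ t ht).deriv_deriv_eq]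
    simp only [A, B]
    field_simp
    ring
  have hw : ∀ t ∈ Ioo r₁ r₂, HasDerivAt (fun s => u₁ s - u₂ s) (deriv u₁ t - deriv u₂ t) t :=
    fun t ht => (hd₁ t ht).sub (hd₂ t ht)
  have hp : ∀ t ∈ Ioo r₁ r₂, HasDerivAt (fun s => deriv u₁ s - deriv u₂ s)
      (A t * (deriv u₁ t - deriv u₂ t) + B t * (u₁ t - u₂ t)) t := fun t ht => by
    rw [← hlin t ht]
    exact (hdd₁ t ht).sub (hdd₂ t ht)
  have hp₀ : deriv u₁ t₀ - deriv u₂ t₀ = 0 := hmax.hasDerivAt_eq_zero (hw t₀ ht₀)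
  have hw₀ : u₁ t₀ - u₂ t₀ = 0 := by
    have hderiv : deriv (fun s => u₁ s - u₂ s) =ᶠ[𝓝 t₀] fun s => deriv u₁ s - deriv u₂ s := by
      filter_upwards [Ioo_mem_nhds ht₀.1 ht₀.2] with t ht using (hw t ht).deriv
    have hle := hmax.deriv_deriv_nonpos (hw t₀ ht₀).continuousAt
    rw [hderiv.deriv_eq, (hp t₀ ht₀).deriv, hp₀, mul_zero, zero_add] at hle
    have hBpos : 0 < B t₀ := by
      have h₁ := hpos₁ t₀ ht₀
      have h₂ := hpos₂ t₀ ht₀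
      positivity
    exact le_antisymm (nonpos_of_mul_nonpos_right hle hBpos) hnn
  exact fun t ht => sub_eq_zero.1
    (eq_zero_of_linear_second_order ht₀ hA hB hw hp hw₀ hp₀ t ht)
end

section
/- Let n ≥ 2, R ≥ 0 and h > 0. There exists a unique solution u_h of the rotational soliton ODE u''/(1+(u')²) + ((n−1)/ρ)·u' = −(1+nu)/u² on a maximal interval [R, r₂(h)) with u_h(R⁺) = h, u_h'(R⁺) = 0 and u_h > 0 (for R = 0 the initial conditions are understood as limits as ρ → 0⁺). Moreover u_h is strictly decreasing and concave on (R, r₂(h)), and r₂(h) < ∞. -/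
open Set Filter Topology

/-- `u` is a maximal positive solution of the radial rotational soliton ODE on
`[R,b)` with initial conditions `u(R⁺) = h`, `u'(R⁺) = 0` (understood as limits),
which cannot be extended as a positive solution past `b`. -/
def IsMaxSol (n : ℕ) (R h b : ℝ) (u : ℝ → ℝ) : Prop :=
  R < b ∧
  (∀ ρ ∈ Set.Ioo R b, ContDiffAt ℝ 2 u ρ ∧ 0 < u ρ ∧ RadODE n u ρ) ∧
  Filter.Tendsto u (𝓝[>] R) (𝓝 h) ∧
  Filter.Tendsto (deriv u) (𝓝[>] R) (𝓝 0) ∧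
  ¬ ∃ (b' : ℝ) (v : ℝ → ℝ), b < b' ∧ Set.EqOn v u (Set.Ioo R b) ∧
      ∀ ρ ∈ Set.Ioo R b', ContDiffAt ℝ 2 v ρ ∧ 0 < v ρ ∧ RadODE n v ρ

/-- The conformal weight `(1 + n x) / x²` on the right-hand side of the soliton equation. -/
noncomputable def solitonWeight (n : ℕ) (x : ℝ) : ℝ := (1 + (n : ℝ) * x) / x ^ 2

lemma solitonWeight_pos (n : ℕ) {x : ℝ} (hx : 0 < x) : 0 < solitonWeight n x := by
  unfold solitonWeight; positivity

lemma hasDerivAt_solitonWeight (n : ℕ) {x : ℝ} (hx : 0 < x) :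
    HasDerivAt (solitonWeight n) (-(2 + n * x) / x ^ 3) x := by
  have h := ((((hasDerivAt_id x).const_mul (n : ℝ)).const_add 1).div
    ((hasDerivAt_id x).pow 2) (by simp [hx.ne']))
  refine h.congr_deriv ?_
  simp only [id, Pi.pow_apply]
  field_simp
  push_cast
  ring

/-- The nonlinearity `(1 + p²) (1 + n x) / x²` is Lipschitz for bounded `p` and for `x` bounded away
from zero. -/
lemma exists_lipschitz_weight (n : ℕ) {K ε : ℝ} (hK : 0 ≤ K) (hε : 0 < ε) :
    ∃ L : ℝ, 0 ≤ L ∧ ∀ p₁ p₂ x₁ x₂ : ℝ, |p₁| ≤ K → |p₂| ≤ K → ε ≤ x₁ → ε ≤ x₂ →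
      |(1 + p₁ ^ 2) * solitonWeight n x₁ - (1 + p₂ ^ 2) * solitonWeight n x₂| ≤
        L * (|p₁ - p₂| + |x₁ - x₂|) := by
  set V := ε⁻¹ with hV
  have hV0 : 0 < V := by positivity
  have hn0 : (0 : ℝ) ≤ n := n.cast_nonneg
  set A := 2 * K * (V ^ 2 + n * V) with hA
  set B := (1 + K ^ 2) * (V ^ 2 * (2 * V + n)) with hB
  have hA0 : 0 ≤ A := by positivity
  have hB0 : 0 ≤ B := by positivity
  refine ⟨A + B, by positivity, fun p₁ p₂ x₁ x₂ hp₁ hp₂ hx₁ hx₂ => ?_⟩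
  have h₁ : 0 < x₁ := hε.trans_le hx₁
  have h₂ : 0 < x₂ := hε.trans_le hx₂
  have hv₁ : x₁⁻¹ ≤ V := inv_anti₀ hε hx₁
  have hv₂ : x₂⁻¹ ≤ V := inv_anti₀ hε hx₂
  have hv₁0 : 0 < x₁⁻¹ := by positivity
  have hv₂0 : 0 < x₂⁻¹ := by positivity
  have e : (1 + p₁ ^ 2) * solitonWeight n x₁ - (1 + p₂ ^ 2) * solitonWeight n x₂ =
      (p₁ - p₂) * ((p₁ + p₂) * (x₁⁻¹ ^ 2 + n * x₁⁻¹)) +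
        (x₁ - x₂) * (-((1 + p₂ ^ 2) * (x₁⁻¹ * x₂⁻¹ * (x₁⁻¹ + x₂⁻¹ + n)))) := by
    unfold solitonWeight
    field_simp
    ring
  have ha : |(p₁ + p₂) * (x₁⁻¹ ^ 2 + n * x₁⁻¹)| ≤ A := by
    rw [abs_mul, abs_of_pos (a := x₁⁻¹ ^ 2 + n * x₁⁻¹) (by positivity), hA]
    have : |p₁ + p₂| ≤ 2 * K := (abs_add_le _ _).trans (by linarith)
    gcongr
  have hb : |-((1 + p₂ ^ 2) * (x₁⁻¹ * x₂⁻¹ * (x₁⁻¹ + x₂⁻¹ + n)))| ≤ B := by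
    rw [abs_neg, abs_of_nonneg (by positivity), hB]
    have h3 : p₂ ^ 2 ≤ K ^ 2 := sq_le_sq' (by linarith [abs_le.1 hp₂]) (abs_le.1 hp₂).2
    have h4 : x₁⁻¹ * x₂⁻¹ ≤ V ^ 2 := by rw [sq]; gcongr
    have h5 : x₁⁻¹ + x₂⁻¹ ≤ 2 * V := by linarith
    gcongr
  rw [e]
  calc _ ≤ |p₁ - p₂| * A + |x₁ - x₂| * B := by
        refine (abs_add_le _ _).trans ?_
        rw [abs_mul (p₁ - p₂), abs_mul (x₁ - x₂)]
        gcongr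
    _ ≤ _ := by nlinarith [abs_nonneg (p₁ - p₂), abs_nonneg (x₁ - x₂)]

/-- The first-order form of the radial initial value problem: `u` is a positive solution on
`(R, b)` with derivative `p`, with `u → h` and `p → 0` at `R`. -/
structure IsRadSol (n : ℕ) (R h b : ℝ) (u p : ℝ → ℝ) : Prop where
  lt : R < b
  pos : ∀ x ∈ Ioo R b, 0 < u x
  hasDerivAt : ∀ x ∈ Ioo R b, HasDerivAt u (p x) x
  hasDerivAt_slope : ∀ x ∈ Ioo R b,
    HasDerivAt p (-((1 + p x ^ 2) * (((n : ℝ) - 1) / x * p x + solitonWeight n (u x)))) x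
  tendsto : Tendsto u (𝓝[>] R) (𝓝 h)
  tendsto_slope : Tendsto p (𝓝[>] R) (𝓝 0)

lemma nonpos_of_hasDerivAt_neg_of_eq_zero {f f' : ℝ → ℝ} {a b : ℝ} (hab : a ≤ b)
    (hf : ∀ x ∈ Icc a b, HasDerivAt f (f' x) x) (ha : f a ≤ 0)
    (h0 : ∀ x ∈ Icc a b, f x = 0 → f' x < 0) : f b ≤ 0 :=
  image_le_of_deriv_right_lt_deriv_boundary (B := fun _ => 0) (B' := fun _ => 0)
    (fun x hx => (hf x hx).continuousAt.continuousWithinAt)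
    (fun x hx => (hf x (Ico_subset_Icc_self hx)).hasDerivWithinAt) ha
    (fun x => hasDerivAt_const x 0) (fun x hx => h0 x (Ico_subset_Icc_self hx))
    (right_mem_Icc.2 hab)

lemma AntitoneOn.le_of_tendsto_nhdsGT {f : ℝ → ℝ} {R c l : ℝ} (hf : AntitoneOn f (Ioo R c))
    (hl : Tendsto f (𝓝[>] R) (𝓝 l)) {x : ℝ} (hx : x ∈ Ioo R c) : f x ≤ l := by
  refine ge_of_tendsto hl ?_
  filter_upwards [Ioo_mem_nhdsGT hx.1] with y hy
  exact hf ⟨hy.1, hy.2.trans hx.2⟩ hx hy.2.le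

lemma antitoneOn_Ioo_of_hasDerivAt {f f' : ℝ → ℝ} {a b : ℝ}
    (hf : ∀ x ∈ Ioo a b, HasDerivAt f (f' x) x) (h : ∀ x ∈ Ioo a b, f' x ≤ 0) :
    AntitoneOn f (Ioo a b) := by
  refine antitoneOn_of_deriv_nonpos (convex_Ioo a b)
    (fun x hx => (hf x hx).continuousAt.continuousWithinAt) ?_ ?_
  · rw [interior_Ioo]
    exact fun x hx => (hf x hx).differentiableAt.differentiableWithinAt
  · rw [interior_Ioo]
    intro x hx
    rw [(hf x hx).deriv]
    exact h x hx

namespace IsRadSol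

variable {n : ℕ} {R h b : ℝ} {u p : ℝ → ℝ}

lemma mono (H : IsRadSol n R h b u p) {c : ℝ} (hc : R < c) (hcb : c ≤ b) :
    IsRadSol n R h c u p where
  lt := hc
  pos x hx := H.pos x ⟨hx.1, hx.2.trans_le hcb⟩
  hasDerivAt x hx := H.hasDerivAt x ⟨hx.1, hx.2.trans_le hcb⟩
  hasDerivAt_slope x hx := H.hasDerivAt_slope x ⟨hx.1, hx.2.trans_le hcb⟩
  tendsto := H.tendsto
  tendsto_slope := H.tendsto_slope

lemma slope_neg (hn : 2 ≤ n) (hR : 0 ≤ R) (H : IsRadSol n R h b u p) :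
    ∀ x ∈ Ioo R b, p x < 0 := by
  have hn1 : (0 : ℝ) ≤ (n : ℝ) - 1 := by
    have : (2 : ℝ) ≤ n := by exact_mod_cast hn
    linarith
  have key : ∀ x ∈ Ioo R b, 0 ≤ p x →
      -((1 + p x ^ 2) * (((n : ℝ) - 1) / x * p x + solitonWeight n (u x))) < 0 := by
    intro x hx h0
    have hx0 : 0 < x := hR.trans_lt hx.1
    have := solitonWeight_pos n (H.pos x hx)
    have : 0 ≤ ((n : ℝ) - 1) / x * p x := by positivity
    rw [neg_lt_zero]
    positivity
  have hle : ∀ x ∈ Ioo R b, p x ≤ 0 := by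
    intro x hx
    by_contra! hpos
    have hall : ∀ y ∈ Ioo R x, 0 < p y := by
      intro y hy
      by_contra! hy0
      have sub : Icc y x ⊆ Ioo R b := fun z hz => ⟨hy.1.trans_le hz.1, hz.2.trans_lt hx.2⟩
      exact hpos.not_ge (nonpos_of_hasDerivAt_neg_of_eq_zero hy.2.le
        (fun z hz => H.hasDerivAt_slope z (sub hz)) hy0
        (fun z hz hz0 => key z (sub hz) hz0.ge))
    have anti : AntitoneOn p (Ioo R x) := antitoneOn_Ioo_of_hasDerivAt
      (fun z hz => H.hasDerivAt_slope z ⟨hz.1, hz.2.trans hx.2⟩)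
      (fun z hz => (key z ⟨hz.1, hz.2.trans hx.2⟩ (hall z hz).le).le)
    obtain ⟨y, hy⟩ := exists_between hx.1
    exact (hall y hy).not_ge (anti.le_of_tendsto_nhdsGT H.tendsto_slope hy)
  intro x hx
  refine (hle x hx).lt_of_ne fun h0 => ?_
  have hmax : IsLocalMax p x := by
    filter_upwards [Ioo_mem_nhds hx.1 hx.2] with y hy
    rw [h0]
    exact hle y hy
  exact (key x hx h0.ge).ne (hmax.hasDerivAt_eq_zero (H.hasDerivAt_slope x hx))

lemma curvature_nonneg (hn : 2 ≤ n) (hR : 0 ≤ R) (H : IsRadSol n R h b u p) :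
    ∀ x ∈ Ioo R b, 0 ≤ ((n : ℝ) - 1) / x * p x + solitonWeight n (u x) := by
  have hn1 : (0 : ℝ) < (n : ℝ) - 1 := by
    have : (2 : ℝ) ≤ n := by exact_mod_cast hn
    linarith
  intro x hx
  by_contra! hneg
  set w : ℝ → ℝ := fun x => ((n : ℝ) - 1) / x * p x + solitonWeight n (u x) with hw
  have hw' : ∀ y ∈ Ioo R b, HasDerivAt w
      (-((n : ℝ) - 1) / y ^ 2 * p y + ((n : ℝ) - 1) / y * (-((1 + p y ^ 2) * w y)) +
        -(2 + n * u y) / u y ^ 3 * p y) y := by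
    intro y hy
    have hy0 : y ≠ 0 := (hR.trans_lt hy.1).ne'
    have h1 := ((hasDerivAt_inv hy0).const_mul ((n : ℝ) - 1)).mul (H.hasDerivAt_slope y hy)
    have h2 := (hasDerivAt_solitonWeight n (H.pos y hy)).comp y (H.hasDerivAt y hy)
    refine (h1.add h2).congr_deriv ?_
    simp only [hw]
    field_simp
  have hall : ∀ y ∈ Ioo R x, w y < 0 := by
    intro y hy
    by_contra! hy0
    have sub : Icc y x ⊆ Ioo R b := fun z hz => ⟨hy.1.trans_le hz.1, hz.2.trans_lt hx.2⟩
    have := nonpos_of_hasDerivAt_neg_of_eq_zero hy.2.le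
      (fun z hz => (hw' z (sub hz)).neg) (by simpa using hy0) (fun z hz hz0 => by
        have hz0' : w z = 0 := by simpa using hz0
        have hzp : 0 < z := hR.trans_lt (sub hz).1
        have hpz := H.slope_neg hn hR z (sub hz)
        have huz := H.pos z (sub hz)
        rw [hz0']
        have h1 : 0 < ((n : ℝ) - 1) / z ^ 2 * -p z :=
          mul_pos (by positivity) (by linarith)
        have h2 : 0 < (2 + n * u z) / u z ^ 3 * -p z :=
          mul_pos (by positivity) (by linarith)
        rw [neg_div, neg_div]
        linarith)
    have : 0 ≤ w x := by simpa using this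
    exact hneg.not_ge this
  have anti : AntitoneOn (fun y => -p y) (Ioo R x) := by
    refine antitoneOn_Ioo_of_hasDerivAt
      (fun z hz => (H.hasDerivAt_slope z ⟨hz.1, hz.2.trans hx.2⟩).neg) fun z hz => ?_
    have := hall z hz
    nlinarith [sq_nonneg (p z)]
  obtain ⟨y, hy⟩ := exists_between hx.1
  have h1 := anti.le_of_tendsto_nhdsGT H.tendsto_slope.neg hy
  have h2 := H.slope_neg hn hR y ⟨hy.1, hy.2.trans hx.2⟩
  simp only [neg_zero] at h1
  linarith

lemma antitoneOn_slope (hn : 2 ≤ n) (hR : 0 ≤ R) (H : IsRadSol n R h b u p) :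
    AntitoneOn p (Ioo R b) :=
  antitoneOn_Ioo_of_hasDerivAt H.hasDerivAt_slope fun x hx =>
    neg_nonpos.2 (mul_nonneg (by positivity) (H.curvature_nonneg hn hR x hx))

lemma strictAntiOn (hn : 2 ≤ n) (hR : 0 ≤ R) (H : IsRadSol n R h b u p) :
    StrictAntiOn u (Ioo R b) := by
  refine strictAntiOn_of_deriv_neg (convex_Ioo R b)
    (fun x hx => (H.hasDerivAt x hx).continuousAt.continuousWithinAt) fun x hx => ?_
  rw [interior_Ioo] at hx
  rw [(H.hasDerivAt x hx).deriv]
  exact H.slope_neg hn hR x hx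

lemma concaveOn (hn : 2 ≤ n) (hR : 0 ≤ R) (H : IsRadSol n R h b u p) :
    ConcaveOn ℝ (Ioo R b) u := by
  refine AntitoneOn.concaveOn_of_deriv (convex_Ioo R b)
    (fun x hx => (H.hasDerivAt x hx).continuousAt.continuousWithinAt) ?_ ?_
  · rw [interior_Ioo]
    exact fun x hx => (H.hasDerivAt x hx).differentiableAt.differentiableWithinAt
  · rw [interior_Ioo]
    intro x hx y hy hxy
    rw [(H.hasDerivAt x hx).deriv, (H.hasDerivAt y hy).deriv]
    exact H.antitoneOn_slope hn hR hx hy hxy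

/-- Two solutions of the same initial value problem agree: the squared distance `E` of the phase
points satisfies `E' ≤ C E`, because the singular term is monotone in the slope. -/
lemma unique (hn : 2 ≤ n) (hR : 0 ≤ R) {u₁ p₁ u₂ p₂ : ℝ → ℝ}
    (H₁ : IsRadSol n R h b u₁ p₁) (H₂ : IsRadSol n R h b u₂ p₂) :
    ∀ x ∈ Ioo R b, u₁ x = u₂ x ∧ p₁ x = p₂ x := by
  intro c hc
  have hn1 : (0 : ℝ) < (n : ℝ) - 1 := by
    have : (2 : ℝ) ≤ n := by exact_mod_cast hn
    linarith
  obtain ⟨c', hcc', hc'b⟩ := exists_between hc.2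
  have hc' : c' ∈ Ioo R b := ⟨hc.1.trans hcc', hc'b⟩
  set ε := min (u₁ c') (u₂ c')
  have hε : 0 < ε := lt_min (H₁.pos c' hc') (H₂.pos c' hc')
  set K := max (-p₁ c') (-p₂ c')
  have hK : 0 ≤ K := le_max_of_le_left (by linarith [H₁.slope_neg hn hR c' hc'])
  obtain ⟨L, hL0, hL⟩ := exists_lipschitz_weight n hK hε
  set C := 1 + 3 * L with hC
  have sub : ∀ x ∈ Ioo R c', x ∈ Ioo R b := fun x hx => ⟨hx.1, hx.2.trans hc'b⟩
  set E : ℝ → ℝ := fun x => ((u₁ x - u₂ x) ^ 2 + (p₁ x - p₂ x) ^ 2) * Real.exp (-C * x) with hE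
  have hE0 : Tendsto E (𝓝[>] R) (𝓝 0) := by
    have h1 := ((H₁.tendsto.sub H₂.tendsto).pow 2).add
      ((H₁.tendsto_slope.sub H₂.tendsto_slope).pow 2)
    have h2 : Tendsto (fun x => Real.exp (-C * x)) (𝓝[>] R) (𝓝 (Real.exp (-C * R))) :=
      ((by fun_prop : Continuous fun x => Real.exp (-C * x)).tendsto R).mono_left
        nhdsWithin_le_nhds
    simpa [hE] using h1.mul h2
  have anti : AntitoneOn E (Ioo R c') := by
    refine antitoneOn_Ioo_of_hasDerivAt (fun x hx =>
      ((((H₁.hasDerivAt x (sub x hx)).sub (H₂.hasDerivAt x (sub x hx))).pow 2).add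
        (((H₁.hasDerivAt_slope x (sub x hx)).sub (H₂.hasDerivAt_slope x (sub x hx))).pow 2)).mul
        (((hasDerivAt_id x).const_mul (-C)).exp)) fun x hx => ?_
    have hxb := sub x hx
    have hx0 : 0 < x := hR.trans_lt hx.1
    have hlip := hL (p₁ x) (p₂ x) (u₁ x) (u₂ x)
      (by
        rw [abs_of_neg (H₁.slope_neg hn hR x hxb)]
        exact le_max_of_le_left (neg_le_neg (H₁.antitoneOn_slope hn hR hxb hc' hx.2.le)))
      (by
        rw [abs_of_neg (H₂.slope_neg hn hR x hxb)]
        exact le_max_of_le_right (neg_le_neg (H₂.antitoneOn_slope hn hR hxb hc' hx.2.le)))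
      (min_le_of_left_le ((H₁.strictAntiOn hn hR).antitoneOn hxb hc' hx.2.le))
      (min_le_of_right_le ((H₂.strictAntiOn hn hR).antitoneOn hxb hc' hx.2.le))
    simp only [Pi.add_apply, Pi.sub_apply, Pi.pow_apply, id]
    set d := p₁ x - p₂ x with hd
    set e := u₁ x - u₂ x with he
    set W := (1 + p₁ x ^ 2) * solitonWeight n (u₁ x) - (1 + p₂ x ^ 2) * solitonWeight n (u₂ x)
      with hW
    have hm : 0 ≤ ((n : ℝ) - 1) / x *
        (d ^ 2 * (1 + (p₁ x ^ 2 + p₁ x * p₂ x + p₂ x ^ 2))) := by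
      have : 0 ≤ p₁ x ^ 2 + p₁ x * p₂ x + p₂ x ^ 2 := by
        nlinarith [sq_nonneg (p₁ x + p₂ x), sq_nonneg (p₁ x), sq_nonneg (p₂ x)]
      positivity
    have hdW : -(d * W) ≤ |d| * (L * (|d| + |e|)) := by
      refine (neg_le_abs _).trans ?_
      rw [abs_mul]
      gcongr
    have hde : d * e ≤ |d| * |e| := by rw [← abs_mul]; exact le_abs_self _
    have hde2 : 2 * (|d| * |e|) ≤ e ^ 2 + d ^ 2 := by
      nlinarith [sq_nonneg (|d| - |e|), sq_abs d, sq_abs e]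
    have hdd : |d| * |d| ≤ e ^ 2 + d ^ 2 := by nlinarith [sq_abs d, sq_nonneg e]
    have hmain : 2 * (e * d) - 2 * (((n : ℝ) - 1) / x *
        (d ^ 2 * (1 + (p₁ x ^ 2 + p₁ x * p₂ x + p₂ x ^ 2))) + d * W) ≤ C * (e ^ 2 + d ^ 2) := by
      rw [hC]
      nlinarith [mul_le_mul_of_nonneg_left hde2 hL0, mul_le_mul_of_nonneg_left hdd hL0]
    have hexp := Real.exp_pos (-C * x)
    have hfin := mul_le_mul_of_nonneg_right hmain hexp.le
    refine le_trans (le_of_eq ?_) (sub_nonpos.2 hfin)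
    rw [hW, hd, he]
    push_cast
    ring
  have h1 := anti.le_of_tendsto_nhdsGT hE0 (x := c) ⟨hc.1, hcc'⟩
  have h2 : (u₁ c - u₂ c) ^ 2 + (p₁ c - p₂ c) ^ 2 ≤ 0 :=
    nonpos_of_mul_nonpos_left h1 (Real.exp_pos _)
  constructor <;> nlinarith [sq_nonneg (u₁ c - u₂ c), sq_nonneg (p₁ c - p₂ c)]

lemma le_add_div (hn : 2 ≤ n) (hR : 0 ≤ R) (H : IsRadSol n R h b u p) {x : ℝ}
    (hx : x ∈ Ioo R b) : b ≤ x + u x / -p x := by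
  by_contra! hlt
  have hpx := H.slope_neg hn hR x hx
  have hux := H.pos x hx
  have hq : 0 < u x / -p x := div_pos hux (by linarith)
  set y := x + u x / -p x with hy
  have hyb : y ∈ Ioo R b := ⟨by linarith [hx.1], hlt⟩
  have h1 := (H.concaveOn hn hR).slope_le_of_hasDerivAt hx hyb (by linarith) (H.hasDerivAt x hx)
  rw [slope_def_field, div_le_iff₀ (by linarith)] at h1
  have h2 : p x * (y - x) = -u x := by
    have := hpx.ne
    rw [hy, add_sub_cancel_left]
    field_simp
  linarith [H.pos y hyb]

end IsRadSol

lemma isRadSol_of_radODE {n : ℕ} {R h b : ℝ} {u : ℝ → ℝ} (hb : R < b)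
    (hu : ∀ x ∈ Ioo R b, ContDiffAt ℝ 2 u x ∧ 0 < u x ∧ RadODE n u x)
    (h0 : Tendsto u (𝓝[>] R) (𝓝 h)) (h1 : Tendsto (deriv u) (𝓝[>] R) (𝓝 0)) :
    IsRadSol n R h b u (deriv u) where
  lt := hb
  pos x hx := (hu x hx).2.1
  hasDerivAt x hx := ((hu x hx).1.differentiableAt two_ne_zero).hasDerivAt
  hasDerivAt_slope x hx := by
    obtain ⟨hc, -, ho⟩ := hu x hx
    have hd : ContDiffAt ℝ 1 (deriv u) x := hc.derivWithin (by norm_num)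
    refine (hd.differentiableAt one_ne_zero).hasDerivAt.congr_deriv ?_
    have hne : 1 + deriv u x ^ 2 ≠ 0 := by positivity
    unfold RadODE at ho
    have e : deriv (deriv u) x / (1 + deriv u x ^ 2) =
        -(((n : ℝ) - 1) / x * deriv u x + solitonWeight n (u x)) := by
      rw [solitonWeight, eq_sub_of_add_eq ho]
      ring
    rw [div_eq_iff hne] at e
    rw [e]
    ring
  tendsto := h0
  tendsto_slope := h1

lemma IsMaxSol.isRadSol {n : ℕ} {R h b : ℝ} {u : ℝ → ℝ} (H : IsMaxSol n R h b u) :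
    IsRadSol n R h b u (deriv u) :=
  isRadSol_of_radODE H.1 H.2.1 H.2.2.1 H.2.2.2.1

namespace IsRadSol

variable {n : ℕ} {R h b : ℝ} {u p : ℝ → ℝ}

lemma deriv_eq (H : IsRadSol n R h b u p) : EqOn (deriv u) p (Ioo R b) :=
  fun x hx => (H.hasDerivAt x hx).deriv

lemma contDiffAt (hR : 0 ≤ R) (H : IsRadSol n R h b u p) {x : ℝ} (hx : x ∈ Ioo R b) :
    ContDiffAt ℝ 2 u x := by
  have hpc : ContinuousOn p (Ioo R b) :=
    fun y hy => (H.hasDerivAt_slope y hy).continuousAt.continuousWithinAt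
  have huc : ContinuousOn u (Ioo R b) :=
    fun y hy => (H.hasDerivAt y hy).continuousAt.continuousWithinAt
  have hp1 : ContDiffOn ℝ (0 + 1) p (Ioo R b) := by
    rw [contDiffOn_succ_iff_deriv_of_isOpen isOpen_Ioo]
    refine ⟨fun y hy => (H.hasDerivAt_slope y hy).differentiableAt.differentiableWithinAt,
      by simp, ?_⟩
    rw [contDiffOn_zero]
    refine ContinuousOn.congr ?_ fun y hy => (H.hasDerivAt_slope y hy).deriv
    have h0 : ∀ y ∈ Ioo R b, y ≠ 0 := fun y hy => (hR.trans_lt hy.1).ne'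
    have h1 : ∀ y ∈ Ioo R b, u y ^ 2 ≠ 0 := fun y hy => pow_ne_zero 2 (H.pos y hy).ne'
    simp only [solitonWeight]
    fun_prop (disch := assumption)
  have hu2 : ContDiffOn ℝ (1 + 1) u (Ioo R b) := by
    rw [contDiffOn_succ_iff_deriv_of_isOpen isOpen_Ioo]
    refine ⟨fun y hy => (H.hasDerivAt y hy).differentiableAt.differentiableWithinAt,
      by simp, ?_⟩
    rw [zero_add] at hp1
    exact hp1.congr H.deriv_eq
  rw [one_add_one_eq_two] at hu2
  exact hu2.contDiffAt (Ioo_mem_nhds hx.1 hx.2)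

lemma radODE (H : IsRadSol n R h b u p) {x : ℝ} (hx : x ∈ Ioo R b) : RadODE n u x := by
  have he : deriv u =ᶠ[𝓝 x] p := by
    filter_upwards [Ioo_mem_nhds hx.1 hx.2] with y hy using H.deriv_eq hy
  unfold RadODE
  rw [he.deriv_eq, he.eq_of_nhds, (H.hasDerivAt_slope x hx).deriv, solitonWeight]
  have : 1 + p x ^ 2 ≠ 0 := by positivity
  field_simp
  ring

lemma tendsto_deriv (H : IsRadSol n R h b u p) : Tendsto (deriv u) (𝓝[>] R) (𝓝 0) := by
  refine H.tendsto_slope.congr' ?_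
  filter_upwards [Ioo_mem_nhdsGT H.lt] with y hy using (H.deriv_eq hy).symm

lemma congr {v q : ℝ → ℝ} (H : IsRadSol n R h b u p) (hv : EqOn v u (Ioo R b))
    (hq : EqOn q p (Ioo R b)) : IsRadSol n R h b v q where
  lt := H.lt
  pos x hx := by rw [hv hx]; exact H.pos x hx
  hasDerivAt x hx := by
    rw [hq hx]
    exact (H.hasDerivAt x hx).congr_of_eventuallyEq
      (hv.eventuallyEq_of_mem (Ioo_mem_nhds hx.1 hx.2))
  hasDerivAt_slope x hx := by
    rw [hq hx, hv hx]
    exact (H.hasDerivAt_slope x hx).congr_of_eventuallyEq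
      (hq.eventuallyEq_of_mem (Ioo_mem_nhds hx.1 hx.2))
  tendsto := H.tendsto.congr' (hv.symm.eventuallyEq_of_mem (Ioo_mem_nhdsGT H.lt))
  tendsto_slope := H.tendsto_slope.congr' (hq.symm.eventuallyEq_of_mem (Ioo_mem_nhdsGT H.lt))

lemma of_forall_lt (hb : R < b) (H : ∀ c ∈ Ioo R b, IsRadSol n R h c u p) :
    IsRadSol n R h b u p := by
  obtain ⟨c, hc⟩ := exists_between hb
  have key : ∀ x ∈ Ioo R b, ∃ d, x ∈ Ioo R d ∧ IsRadSol n R h d u p := fun x hx => by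
    obtain ⟨d, hxd, hdb⟩ := exists_between hx.2
    exact ⟨d, ⟨hx.1, hxd⟩, H d ⟨hx.1.trans hxd, hdb⟩⟩
  refine ⟨hb, fun x hx => ?_, fun x hx => ?_, fun x hx => ?_, (H c hc).tendsto,
    (H c hc).tendsto_slope⟩ <;> obtain ⟨d, hxd, hd⟩ := key x hx
  exacts [hd.pos x hxd, hd.hasDerivAt x hxd, hd.hasDerivAt_slope x hxd]

lemma eqOn_min (hn : 2 ≤ n) (hR : 0 ≤ R) {b₁ b₂ : ℝ} {u₁ p₁ u₂ p₂ : ℝ → ℝ}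
    (H₁ : IsRadSol n R h b₁ u₁ p₁) (H₂ : IsRadSol n R h b₂ u₂ p₂) {x : ℝ} (hx : R < x)
    (h₁ : x < b₁) (h₂ : x < b₂) : u₁ x = u₂ x ∧ p₁ x = p₂ x :=
  have hm : R < min b₁ b₂ := lt_min H₁.lt H₂.lt
  unique hn hR (H₁.mono hm (min_le_left _ _)) (H₂.mono hm (min_le_right _ _)) x
    ⟨hx, lt_min h₁ h₂⟩

/-- Any local solution of the initial value problem extends to a solution on a bounded interval
which contains the interval of every other solution. -/
lemma exists_greatest (hn : 2 ≤ n) (hR : 0 ≤ R) (H : IsRadSol n R h b u p) :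
    ∃ B v q, IsRadSol n R h B v q ∧ ∀ b' u' p', IsRadSol n R h b' u' p' → b' ≤ B := by
  set S : Set ℝ := {c | ∃ v q, IsRadSol n R h c v q} with hS
  have hbS : b ∈ S := ⟨u, p, H⟩
  obtain ⟨x₀, hx₀⟩ := exists_between H.lt
  have hbdd : BddAbove S := by
    refine ⟨max b (x₀ + u x₀ / -p x₀), ?_⟩
    rintro c ⟨v, q, hc⟩
    rcases le_or_gt c b with hcb | hcb
    · exact le_max_of_le_left hcb
    · have hx₀c := hx₀.2.trans hcb
      obtain ⟨e₁, e₂⟩ := eqOn_min hn hR hc H hx₀.1 hx₀c hx₀.2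
      rw [← e₁, ← e₂]
      exact le_max_of_le_right (hc.le_add_div hn hR ⟨hx₀.1, hx₀c⟩)
  have hlt : R < sSup S := H.lt.trans_le (le_csSup hbdd hbS)
  have hex : ∀ x, ∃ c v q, x < sSup S → x < c ∧ IsRadSol n R h c v q := by
    intro x
    by_cases hx : x < sSup S
    · obtain ⟨c, ⟨v, q, hc⟩, hxc⟩ := exists_lt_of_lt_csSup ⟨b, hbS⟩ hx
      exact ⟨c, v, q, fun _ => ⟨hxc, hc⟩⟩
    · exact ⟨0, u, p, fun h => absurd h hx⟩
  choose c v q hcvq using hex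
  refine ⟨sSup S, fun x => v x x, fun x => q x x, of_forall_lt hlt fun d hd => ?_,
    fun b' u' p' H' => le_csSup hbdd ⟨u', p', H'⟩⟩
  obtain ⟨hdc, hsol⟩ := hcvq d hd.2
  have agree : ∀ x ∈ Ioo R d, v x x = v d x ∧ q x x = q d x := fun x hx => by
    obtain ⟨hxc, hx'⟩ := hcvq x (hx.2.trans hd.2)
    exact eqOn_min hn hR hx' hsol hx.1 hxc (hx.2.trans hdc)
  exact (hsol.mono hd.1 hdc.le).congr (fun x hx => (agree x hx).1) fun x hx => (agree x hx).2

end IsRadSol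

/-- A map on functions on `(a, b)` which preserves the continuous functions bounded by `M` and
halves distances between them has a fixed point. -/
lemma exists_fixedPoint_continuousOn_Ioo {a b M : ℝ} (hM : 0 ≤ M) (T : (ℝ → ℝ) → ℝ → ℝ)
    (hc : ∀ f, ContinuousOn f (Ioo a b) → (∀ x ∈ Ioo a b, |f x| ≤ M) →
      ContinuousOn (T f) (Ioo a b))
    (hb : ∀ f, ContinuousOn f (Ioo a b) → (∀ x ∈ Ioo a b, |f x| ≤ M) →
      ∀ x ∈ Ioo a b, |T f x| ≤ M)
    (hd : ∀ f g d, ContinuousOn f (Ioo a b) → (∀ x ∈ Ioo a b, |f x| ≤ M) →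
      ContinuousOn g (Ioo a b) → (∀ x ∈ Ioo a b, |g x| ≤ M) → 0 ≤ d →
      (∀ x ∈ Ioo a b, |f x - g x| ≤ d) → ∀ x ∈ Ioo a b, |T f x - T g x| ≤ 1 / 2 * d) :
    ∃ f, ContinuousOn f (Ioo a b) ∧ (∀ x ∈ Ioo a b, |f x| ≤ M) ∧ ∀ x ∈ Ioo a b, T f x = f x := by
  have hMM : -M ≤ M := by linarith
  let ext : BoundedContinuousFunction (Ioo a b) ℝ → ℝ → ℝ := fun F x =>
    open Classical in if hx : x ∈ Ioo a b then (projIcc (-M) M hMM (F ⟨x, hx⟩) : ℝ) else 0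
  have ext_apply : ∀ F (x : Ioo a b), ext F x = projIcc (-M) M hMM (F x) := fun F x =>
    dif_pos x.2
  have ext_cont : ∀ F, ContinuousOn (ext F) (Ioo a b) := fun F => by
    rw [continuousOn_iff_continuous_domRestrict]
    have : (Ioo a b).domRestrict (ext F) = fun x => (projIcc (-M) M hMM (F x) : ℝ) :=
      funext fun x => ext_apply F x
    rw [this]
    exact continuous_subtype_val.comp (continuous_projIcc.comp F.continuous)
  have ext_bound : ∀ F, ∀ x ∈ Ioo a b, |ext F x| ≤ M := fun F x hx => by
    rw [ext_apply F ⟨x, hx⟩]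
    exact abs_le.2 (projIcc (-M) M hMM _).2
  let Φ : BoundedContinuousFunction (Ioo a b) ℝ → BoundedContinuousFunction (Ioo a b) ℝ :=
    fun F => BoundedContinuousFunction.ofNormedAddCommGroup (fun x : Ioo a b => T (ext F) x)
      (continuousOn_iff_continuous_domRestrict.1 (hc _ (ext_cont F) (ext_bound F))) M
      (fun x => hb _ (ext_cont F) (ext_bound F) x x.2)
  have hΦ : ContractingWith (1 / 2) Φ := by
    refine ⟨by norm_num, LipschitzWith.of_dist_le_mul fun F G => ?_⟩
    rw [BoundedContinuousFunction.dist_le (by positivity)]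
    intro x
    refine hd (ext F) (ext G) (dist F G) (ext_cont F) (ext_bound F) (ext_cont G) (ext_bound G)
      dist_nonneg (fun y hy => ?_) x x.2
    rw [ext_apply F ⟨y, hy⟩, ext_apply G ⟨y, hy⟩]
    have := BoundedContinuousFunction.dist_coe_le_dist (f := F) (g := G) ⟨y, hy⟩
    rw [Real.dist_eq] at this
    exact (abs_projIcc_sub_projIcc hMM).trans this
  set F := ContractingWith.fixedPoint Φ hΦ
  have hF : ∀ x : Ioo a b, T (ext F) x = F x := fun x =>
    DFunLike.congr_fun hΦ.fixedPoint_isFixedPt x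
  refine ⟨ext F, ext_cont F, ext_bound F, fun x hx => ?_⟩
  rw [hF ⟨x, hx⟩, ext_apply F ⟨x, hx⟩, projIcc_of_mem]
  rw [← hF ⟨x, hx⟩]
  exact abs_le.1 (hb _ (ext_cont F) (ext_bound F) x hx)

section Integral

variable {f : ℝ → ℝ} {a b C x : ℝ}

lemma intervalIntegrable_of_continuousOn_Ioo (hf : ContinuousOn f (Ioo a b))
    (hC : ∀ y ∈ Ioo a b, |f y| ≤ C) (hx : x ∈ Ioo a b) :
    IntervalIntegrable f MeasureTheory.volume a x := by
  rw [intervalIntegrable_iff_integrableOn_Ioo_of_le hx.1.le]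
  have : MeasureTheory.IntegrableOn f (Ioo a b) :=
    MeasureTheory.IntegrableOn.of_bound (by simp)
      (hf.aestronglyMeasurable measurableSet_Ioo) C
      (MeasureTheory.ae_restrict_of_forall_mem measurableSet_Ioo hC)
  exact this.mono_set (Ioo_subset_Ioo_right hx.2.le)

lemma hasDerivAt_integral_of_continuousOn_Ioo (hf : ContinuousOn f (Ioo a b))
    (hC : ∀ y ∈ Ioo a b, |f y| ≤ C) (hx : x ∈ Ioo a b) :
    HasDerivAt (fun y => ∫ s in a..y, f s) (f x) x :=
  intervalIntegral.integral_hasDerivAt_right (intervalIntegrable_of_continuousOn_Ioo hf hC hx)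
    (hf.stronglyMeasurableAtFilter isOpen_Ioo x hx) (hf.continuousAt (Ioo_mem_nhds hx.1 hx.2))

lemma abs_integral_le_of_Ioo (hC : ∀ y ∈ Ioo a b, |f y| ≤ C) (hx : x ∈ Ioo a b) :
    |∫ s in a..x, f s| ≤ C * (x - a) := by
  have := intervalIntegral.norm_integral_le_of_norm_le_const (a := a) (b := x) (f := f) (C := C)
    fun y hy => by
      rw [uIoc_of_le hx.1.le] at hy
      exact hC y ⟨hy.1, hy.2.trans_lt hx.2⟩
  rwa [abs_of_pos (sub_pos.2 hx.1)] at this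

end Integral

/-- The solution `p` of `p' + (m / x) p = -f` with `p = 0` at `R`. -/
noncomputable def radialSlope (m : ℕ) (R : ℝ) (f : ℝ → ℝ) (x : ℝ) : ℝ :=
  -(∫ s in R..x, s ^ m * f s) / x ^ m

section RadialSlope

variable {m : ℕ} {R b C x : ℝ} {f g : ℝ → ℝ}

lemma abs_pow_mul_le (hR : 0 ≤ R) (hC : ∀ y ∈ Ioo R b, |f y| ≤ C) :
    ∀ y ∈ Ioo R b, |y ^ m * f y| ≤ b ^ m * C := fun y hy => by
  have hy0 : 0 ≤ y := hR.trans hy.1.le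
  rw [abs_mul, abs_of_nonneg (pow_nonneg hy0 m)]
  have := hy.2.le
  have := hC y hy
  have := hy0.trans hy.2.le
  gcongr

lemma abs_radialSlope_le (hR : 0 ≤ R) (hC : ∀ y ∈ Ioo R b, |f y| ≤ C) (hx : x ∈ Ioo R b) :
    |radialSlope m R f x| ≤ C * (x - R) := by
  have hx0 : 0 < x := hR.trans_lt hx.1
  rw [radialSlope, abs_div, abs_neg, abs_of_pos (pow_pos hx0 m), div_le_iff₀ (pow_pos hx0 m)]
  have := intervalIntegral.norm_integral_le_of_norm_le_const (a := R) (b := x)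
    (f := fun s => s ^ m * f s) (C := x ^ m * C) fun y hy => by
      rw [uIoc_of_le hx.1.le] at hy
      have hy0 : 0 ≤ y := hR.trans hy.1.le
      rw [Real.norm_eq_abs, abs_mul, abs_of_nonneg (pow_nonneg hy0 m)]
      have := hy.2
      have := hC y ⟨hy.1, hy.2.trans_lt hx.2⟩
      gcongr
  rw [abs_of_pos (sub_pos.2 hx.1), Real.norm_eq_abs] at this
  linarith

lemma hasDerivAt_radialSlope (hR : 0 ≤ R) (hf : ContinuousOn f (Ioo R b))
    (hC : ∀ y ∈ Ioo R b, |f y| ≤ C) (hx : x ∈ Ioo R b) :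
    HasDerivAt (radialSlope m R f) (-f x - m / x * radialSlope m R f x) x := by
  have hx0 : x ≠ 0 := (hR.trans_lt hx.1).ne'
  have h1 := hasDerivAt_integral_of_continuousOn_Ioo (f := fun s => s ^ m * f s)
    (by fun_prop) (abs_pow_mul_le hR hC) hx
  refine (h1.neg.div (hasDerivAt_pow m x) (pow_ne_zero m hx0)).congr_deriv ?_
  rw [radialSlope]
  simp only [Pi.neg_apply]
  rcases m with _ | m
  · simp
  · field_simp
    simp only [Nat.add_sub_cancel]
    ring

lemma continuousOn_radialSlope (hR : 0 ≤ R) (hf : ContinuousOn f (Ioo R b))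
    (hC : ∀ y ∈ Ioo R b, |f y| ≤ C) : ContinuousOn (radialSlope m R f) (Ioo R b) :=
  fun _ hx => (hasDerivAt_radialSlope hR hf hC hx).continuousAt.continuousWithinAt

lemma radialSlope_sub (hR : 0 ≤ R) (hf : ContinuousOn f (Ioo R b))
    (hfC : ∀ y ∈ Ioo R b, |f y| ≤ C) (hg : ContinuousOn g (Ioo R b))
    (hgC : ∀ y ∈ Ioo R b, |g y| ≤ C) (hx : x ∈ Ioo R b) :
    radialSlope m R f x - radialSlope m R g x = radialSlope m R (fun y => f y - g y) x := by
  have hfi := intervalIntegrable_of_continuousOn_Ioo (f := fun s => s ^ m * f s)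
    (by fun_prop) (abs_pow_mul_le hR hfC) hx
  have hgi := intervalIntegrable_of_continuousOn_Ioo (f := fun s => s ^ m * g s)
    (by fun_prop) (abs_pow_mul_le hR hgC) hx
  simp only [radialSlope, mul_sub]
  rw [intervalIntegral.integral_sub hfi hgi]
  ring

end RadialSlope

/-- The function with value `h` at `R` and derivative `radialSlope m R f`. -/
noncomputable def radialHeight (m : ℕ) (R h : ℝ) (f : ℝ → ℝ) (x : ℝ) : ℝ :=
  h + ∫ s in R..x, radialSlope m R f s

section RadialHeight

variable {m : ℕ} {R h δ C d x : ℝ} {f g : ℝ → ℝ}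

lemma abs_radialSlope_le_const (hR : 0 ≤ R) (hC0 : 0 ≤ C)
    (hC : ∀ y ∈ Ioo R (R + δ), |f y| ≤ C) (hx : x ∈ Ioo R (R + δ)) :
    |radialSlope m R f x| ≤ C * δ :=
  (abs_radialSlope_le hR hC hx).trans
    (mul_le_mul_of_nonneg_left (by linarith [hx.2]) hC0)

lemma hasDerivAt_radialHeight (hR : 0 ≤ R) (hC0 : 0 ≤ C) (hf : ContinuousOn f (Ioo R (R + δ)))
    (hC : ∀ y ∈ Ioo R (R + δ), |f y| ≤ C) (hx : x ∈ Ioo R (R + δ)) :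
    HasDerivAt (radialHeight m R h f) (radialSlope m R f x) x :=
  (hasDerivAt_integral_of_continuousOn_Ioo (continuousOn_radialSlope hR hf hC)
    (fun _ hy => abs_radialSlope_le_const hR hC0 hC hy) hx).const_add h

lemma abs_radialHeight_sub_le (hR : 0 ≤ R) (hC0 : 0 ≤ C)
    (hC : ∀ y ∈ Ioo R (R + δ), |f y| ≤ C) (hx : x ∈ Ioo R (R + δ)) :
    |radialHeight m R h f x - h| ≤ C * δ * (x - R) := by
  rw [radialHeight, add_sub_cancel_left]
  exact abs_integral_le_of_Ioo (fun _ hy => abs_radialSlope_le_const hR hC0 hC hy) hx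

lemma abs_radialSlope_sub_le (hR : 0 ≤ R) (hf : ContinuousOn f (Ioo R (R + δ)))
    (hfC : ∀ y ∈ Ioo R (R + δ), |f y| ≤ C) (hg : ContinuousOn g (Ioo R (R + δ)))
    (hgC : ∀ y ∈ Ioo R (R + δ), |g y| ≤ C) (hd0 : 0 ≤ d)
    (hd : ∀ y ∈ Ioo R (R + δ), |f y - g y| ≤ d) (hx : x ∈ Ioo R (R + δ)) :
    |radialSlope m R f x - radialSlope m R g x| ≤ d * δ := by
  rw [radialSlope_sub hR hf hfC hg hgC hx]
  exact abs_radialSlope_le_const hR hd0 hd hx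

lemma abs_radialHeight_sub_radialHeight_le (hR : 0 ≤ R) (hδ : 0 ≤ δ) (hδ1 : δ ≤ 1) (hC0 : 0 ≤ C)
    (hf : ContinuousOn f (Ioo R (R + δ)))
    (hfC : ∀ y ∈ Ioo R (R + δ), |f y| ≤ C) (hg : ContinuousOn g (Ioo R (R + δ)))
    (hgC : ∀ y ∈ Ioo R (R + δ), |g y| ≤ C) (hd0 : 0 ≤ d)
    (hd : ∀ y ∈ Ioo R (R + δ), |f y - g y| ≤ d) (hx : x ∈ Ioo R (R + δ)) :
    |radialHeight m R h f x - radialHeight m R h g x| ≤ d * δ := by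
  have hfi := intervalIntegrable_of_continuousOn_Ioo (continuousOn_radialSlope (m := m) hR hf hfC)
    (fun _ hy => abs_radialSlope_le_const hR hC0 hfC hy) hx
  have hgi := intervalIntegrable_of_continuousOn_Ioo (continuousOn_radialSlope (m := m) hR hg hgC)
    (fun _ hy => abs_radialSlope_le_const hR hC0 hgC hy) hx
  rw [radialHeight, radialHeight, add_sub_add_left_eq_sub,
    ← intervalIntegral.integral_sub hfi hgi]
  refine (abs_integral_le_of_Ioo
    (fun _ hy => abs_radialSlope_sub_le hR hf hfC hg hgC hd0 hd hy) hx).trans ?_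
  exact mul_le_of_le_one_right (by positivity) (by linarith [hx.2])

end RadialHeight

lemma solitonWeight_le (n : ℕ) {ε x : ℝ} (hε : 0 < ε) (hx : ε ≤ x) :
    solitonWeight n x ≤ solitonWeight n ε := by
  have e : ∀ y : ℝ, 0 < y → solitonWeight n y = y⁻¹ ^ 2 + n * y⁻¹ := fun y hy => by
    unfold solitonWeight
    field_simp
  rw [e x (hε.trans_le hx), e ε hε]
  have := inv_anti₀ hε hx
  have : 0 < x⁻¹ := inv_pos.2 (hε.trans_le hx)
  gcongr

lemma exists_pos_mul_le_one {A B D E F : ℝ} (hA : 0 ≤ A) (hB : 0 ≤ B) (hD : 0 ≤ D) (hE : 0 ≤ E)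
    (hF : 0 ≤ F) :
    ∃ δ : ℝ, 0 < δ ∧ A * δ ≤ 1 ∧ B * δ ≤ 1 ∧ D * δ ≤ 1 ∧ E * δ ≤ 1 ∧ F * δ ≤ 1 := by
  have h0 : 0 < 1 + A + B + D + E + F := by positivity
  have key : ∀ y, y ≤ 1 + A + B + D + E + F → y * (1 + A + B + D + E + F)⁻¹ ≤ 1 := fun y hy => by
    rw [← div_eq_mul_inv]
    exact div_le_one_of_le₀ hy h0.le
  exact ⟨_, inv_pos.2 h0, key _ (by linarith), key _ (by linarith), key _ (by linarith),
    key _ (by linarith), key _ (by linarith)⟩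

/-- Local existence, by a contraction argument for `f = (m / x) p³ + (1 + p²) (1 + n u) / u²` with
`p = radialSlope m R f` and `u = radialHeight m R h f`, where `m = n - 1`. -/
lemma exists_isRadSol {n : ℕ} (hn : 2 ≤ n) {R h : ℝ} (hR : 0 ≤ R) (hh : 0 < h) :
    ∃ b u p, IsRadSol n R h b u p := by
  obtain ⟨m, rfl⟩ : ∃ m, n = m + 1 := ⟨n - 1, by omega⟩
  have hm0 : (0 : ℝ) ≤ m := m.cast_nonneg
  have hε : 0 < h / 2 := by positivity
  obtain ⟨L, hL0, hL⟩ := exists_lipschitz_weight (m + 1) (K := 1) zero_le_one hε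
  set G := solitonWeight (m + 1) (h / 2) with hG
  have hG0 : 0 < G := solitonWeight_pos _ hε
  set M := 2 * G + 1 with hM
  have hM0 : 0 < M := by positivity
  obtain ⟨δ, hδ, hδ1, hδM, hδm, hδL, hδh⟩ := exists_pos_mul_le_one (A := 1) (B := M)
    (D := m * M * M) (E := 2 * (3 * (m * M) + 2 * L)) (F := M * (2 / h)) zero_le_one hM0.le
    (by positivity) (by positivity) (by positivity)
  rw [one_mul] at hδ1
  have hδh' : M * δ ≤ h / 2 := by
    rw [show M * (2 / h) * δ = M * δ / (h / 2) by field_simp] at hδh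
    exact (div_le_one hε).1 hδh
  set P := radialSlope m R with hP
  set U := radialHeight m R h with hU
  set T : (ℝ → ℝ) → ℝ → ℝ := fun f x =>
    m / x * P f x ^ 3 + (1 + P f x ^ 2) * solitonWeight (m + 1) (U f x) with hT
  have hPM : ∀ f, (∀ y ∈ Ioo R (R + δ), |f y| ≤ M) → ∀ x ∈ Ioo R (R + δ), |P f x| ≤ M * δ :=
    fun f hf x hx => abs_radialSlope_le_const hR hM0.le hf hx
  have hPx : ∀ f, (∀ y ∈ Ioo R (R + δ), |f y| ≤ M) → ∀ x ∈ Ioo R (R + δ), |P f x| ≤ M * x :=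
    fun f hf x hx => (abs_radialSlope_le hR hf hx).trans
      (mul_le_mul_of_nonneg_left (by linarith) hM0.le)
  have hUh : ∀ f, (∀ y ∈ Ioo R (R + δ), |f y| ≤ M) → ∀ x ∈ Ioo R (R + δ), h / 2 ≤ U f x := by
    intro f hf x hx
    have h1 : |U f x - h| ≤ M * δ * (x - R) := abs_radialHeight_sub_le hR hM0.le hf hx
    have h2 : M * δ * (x - R) ≤ M * δ :=
      mul_le_of_le_one_right (by positivity) (by linarith [hx.2])
    linarith [(abs_le.1 h1).1]
  obtain ⟨f, hfc, hfM, hf⟩ := exists_fixedPoint_continuousOn_Ioo (a := R) (b := R + δ) hM0.le T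
    (fun f hfc hfM => by
      have h0 : ∀ y ∈ Ioo R (R + δ), y ≠ 0 := fun y hy => (hR.trans_lt hy.1).ne'
      have h1 : ∀ y ∈ Ioo R (R + δ), U f y ^ 2 ≠ 0 := fun y hy =>
        pow_ne_zero 2 (hε.trans_le (hUh f hfM y hy)).ne'
      have h2 : ContinuousOn (P f) (Ioo R (R + δ)) := continuousOn_radialSlope hR hfc hfM
      have h3 : ContinuousOn (U f) (Ioo R (R + δ)) := fun y hy =>
        (hasDerivAt_radialHeight hR hM0.le hfc hfM hy).continuousAt.continuousWithinAt
      simp only [hT, solitonWeight]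
      fun_prop (disch := assumption))
    (fun f hfc hfM x hx => by
      have hx0 : 0 < x := hR.trans_lt hx.1
      have h1 := hPM f hfM x hx
      have h2 := hPx f hfM x hx
      have h3 := solitonWeight_le (m + 1) hε (hUh f hfM x hx)
      have h4 := (solitonWeight_pos (m + 1) (hε.trans_le (hUh f hfM x hx))).le
      have hP1 : P f x ^ 2 ≤ 1 := by
        rw [sq_le_one_iff_abs_le_one]
        exact h1.trans hδM
      have h5 : |m / x * P f x ^ 3| ≤ 1 := by
        calc |m / x * P f x ^ 3| = m / x * |P f x| * |P f x| * |P f x| := by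
              rw [abs_mul, abs_of_nonneg (by positivity), abs_pow]; ring
          _ ≤ m / x * (M * x) * (M * δ) * 1 := by
              have := h1.trans hδM
              gcongr
          _ = m * M * M * δ := by field_simp
          _ ≤ 1 := hδm
      have h6 : |(1 + P f x ^ 2) * solitonWeight (m + 1) (U f x)| ≤ 2 * G := by
        rw [abs_of_nonneg (by positivity)]
        have : 1 + P f x ^ 2 ≤ 2 := by linarith
        gcongr
      refine (abs_add_le _ _).trans ?_
      linarith)
    (fun f g d hfc hfM hgc hgM hd0 hd x hx => by
      have hx0 : 0 < x := hR.trans_lt hx.1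
      have f1 := hPM f hfM x hx
      have f2 := hPx f hfM x hx
      have g1 := hPM g hgM x hx
      have g2 := hPx g hgM x hx
      have h1 : |P f x - P g x| ≤ d * δ := abs_radialSlope_sub_le hR hfc hfM hgc hgM hd0 hd hx
      have h2 : |U f x - U g x| ≤ d * δ :=
        abs_radialHeight_sub_radialHeight_le hR hδ.le hδ1 hM0.le hfc hfM hgc hgM hd0 hd hx
      have h3 := hL (P f x) (P g x) (U f x) (U g x) (f1.trans hδM) (g1.trans hδM)
        (hUh f hfM x hx) (hUh g hgM x hx)
      have h4 : |P f x ^ 2 + P f x * P g x + P g x ^ 2| ≤ 3 * (M * x) := by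
        have hs : ∀ r s : ℝ, |r| ≤ M * δ → |s| ≤ M * x → |r * s| ≤ M * x := fun r s hr hs => by
          rw [abs_mul, ← one_mul (M * x)]
          exact mul_le_mul (hr.trans hδM) hs (abs_nonneg _) zero_le_one
        have e1 := hs _ _ f1 f2
        have e2 := hs _ _ f1 g2
        have e3 := hs _ _ g1 g2
        rw [sq, sq]
        refine (abs_add_le _ _).trans ?_
        have := abs_add_le (P f x * P f x) (P f x * P g x)
        linarith
      have h5 : |m / x * (P f x ^ 3 - P g x ^ 3)| ≤ 3 * (m * M) * (d * δ) := by
        calc |m / x * (P f x ^ 3 - P g x ^ 3)|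
            = m / x * (|P f x - P g x| * |P f x ^ 2 + P f x * P g x + P g x ^ 2|) := by
              rw [← abs_mul, abs_mul, abs_of_nonneg (by positivity : 0 ≤ m / x)]
              congr 2
              ring
          _ ≤ m / x * (d * δ * (3 * (M * x))) := by gcongr
          _ = _ := by field_simp
      have e : T f x - T g x = m / x * (P f x ^ 3 - P g x ^ 3) +
          ((1 + P f x ^ 2) * solitonWeight (m + 1) (U f x) -
            (1 + P g x ^ 2) * solitonWeight (m + 1) (U g x)) := by
        simp only [hT]; ring
      rw [e]
      refine (abs_add_le _ _).trans ?_
      have h6 : L * (|P f x - P g x| + |U f x - U g x|) ≤ L * (d * δ + d * δ) := by gcongr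
      have h7 := mul_le_mul_of_nonneg_left hδL hd0
      linarith)
  have hRδ : R < R + δ := by linarith
  refine ⟨R + δ, U f, P f, hRδ, fun x hx => hε.trans_le (hUh f hfM x hx),
    fun x hx => hasDerivAt_radialHeight hR hM0.le hfc hfM hx, fun x hx => ?_, ?_, ?_⟩
  · refine (hasDerivAt_radialSlope hR hfc hfM hx).congr_deriv ?_
    rw [← hf x hx]
    simp only [hT]
    push_cast
    ring
  · rw [tendsto_iff_dist_tendsto_zero]
    refine squeeze_zero' (Eventually.of_forall fun _ => dist_nonneg) (g := fun x => M * δ * (x - R))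
      ?_ ?_
    · filter_upwards [Ioo_mem_nhdsGT hRδ] with x hx
      exact abs_radialHeight_sub_le hR hM0.le hfM hx
    · have : Tendsto (fun x => M * δ * (x - R)) (𝓝 R) (𝓝 (M * δ * (R - R))) :=
        (by fun_prop : Continuous fun x => M * δ * (x - R)).tendsto R
      simpa using this.mono_left nhdsWithin_le_nhds
  · rw [tendsto_zero_iff_abs_tendsto_zero]
    refine squeeze_zero' (Eventually.of_forall fun _ => abs_nonneg _) (g := fun x => M * (x - R))
      ?_ ?_
    · filter_upwards [Ioo_mem_nhdsGT hRδ] with x hx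
      exact abs_radialSlope_le hR hfM hx
    · have : Tendsto (fun x => M * (x - R)) (𝓝 R) (𝓝 (M * (R - R))) :=
        (by fun_prop : Continuous fun x => M * (x - R)).tendsto R
      simpa using this.mono_left nhdsWithin_le_nhds

/-- Lemma 3.9, first part: for `R ≥ 0`, `h > 0` there is a unique
maximal positive solution `u_h` on `[R, r₂(h))` with `u_h(R⁺) = h`, `u_h'(R⁺) = 0`;
it is strictly decreasing and concave, and `r₂(h) < ∞` (finiteness is encoded by
`r₂(h) = b ∈ ℝ` together with maximality). -/
theorem rot_soliton_existence_uniqueness (n : ℕ) (hn : 2 ≤ n)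
    (R h : ℝ) (hR : 0 ≤ R) (hh : 0 < h) :
    (∃ b : ℝ, ∃ u : ℝ → ℝ, IsMaxSol n R h b u) ∧
    (∀ b₁ b₂ : ℝ, ∀ u₁ u₂ : ℝ → ℝ, IsMaxSol n R h b₁ u₁ → IsMaxSol n R h b₂ u₂ →
      b₁ = b₂ ∧ Set.EqOn u₁ u₂ (Set.Ioo R b₁)) ∧
    (∀ b : ℝ, ∀ u : ℝ → ℝ, IsMaxSol n R h b u →
      StrictAntiOn u (Set.Ioo R b) ∧ ConcaveOn ℝ (Set.Ioo R b) u) := by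
  refine ⟨?_, ?_, fun b u H => ⟨H.isRadSol.strictAntiOn hn hR, H.isRadSol.concaveOn hn hR⟩⟩
  · obtain ⟨c, v, q, H₀⟩ := exists_isRadSol hn hR hh
    obtain ⟨b, u, p, H, hmax⟩ := H₀.exists_greatest hn hR
    refine ⟨b, u, H.lt, fun x hx => ⟨H.contDiffAt hR hx, H.pos x hx, H.radODE hx⟩, H.tendsto,
      H.tendsto_deriv, ?_⟩
    rintro ⟨b', w, hbb', hwu, hw⟩
    have h0 : Tendsto w (𝓝[>] R) (𝓝 h) :=
      H.tendsto.congr' (hwu.symm.eventuallyEq_of_mem (Ioo_mem_nhdsGT H.lt))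
    have h1 : Tendsto (deriv w) (𝓝[>] R) (𝓝 0) :=
      H.tendsto_deriv.congr'
        ((hwu.deriv isOpen_Ioo).symm.eventuallyEq_of_mem (Ioo_mem_nhdsGT H.lt))
    exact hbb'.not_ge (hmax b' w _ (isRadSol_of_radODE (H.lt.trans hbb') hw h0 h1))
  · have key : ∀ b₁ b₂ : ℝ, ∀ u₁ u₂ : ℝ → ℝ, IsMaxSol n R h b₁ u₁ → IsMaxSol n R h b₂ u₂ →
        b₂ ≤ b₁ := by
      intro b₁ b₂ u₁ u₂ H₁ H₂
      by_contra! hlt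
      exact H₁.2.2.2.2 ⟨b₂, u₂, hlt, fun x hx => (IsRadSol.eqOn_min hn hR H₂.isRadSol
        H₁.isRadSol hx.1 (hx.2.trans hlt) hx.2).1, H₂.2.1⟩
    intro b₁ b₂ u₁ u₂ H₁ H₂
    obtain rfl := le_antisymm (key b₂ b₁ u₂ u₁ H₂ H₁) (key b₁ b₂ u₁ u₂ H₁ H₂)
    exact ⟨rfl, fun x hx => (IsRadSol.unique hn hR H₁.isRadSol H₂.isRadSol x hx).1⟩
end
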